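/- There exist constants C₁, C₂, C₃, C₄, C₅ > 0, depending only on L, D and k₂, with the following property: for every T > 0 and every classical solution w of the full damped inextensible cantilever system with p ≡ 0 on [0,L]×[0,T], the function X(t) = X₀(t) + X₁(t) + X₂(t) + X₃(t) satisfies X(T) + C₁ ∫₀ᵀ X(s) ds ≤ C₂ X(0) + C₃ [X(0)² + X(0)⁹ + X(0)¹⁶] + C₄ [X(T)² + X(T)⁹] + C₅ ∫₀ᵀ [X(s)² + X(s)³ + X(s)^{10/3} + X(s)⁴ + X(s)⁶ + X(s)⁹ + X(s)¹⁷] ds. -/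

import Mathlib

open MeasureTheory Set

/-- Spatial partial derivative of a function of `(x, t)`. -/
noncomputable def pdx (f : ℝ → ℝ → ℝ) : ℝ → ℝ → ℝ := fun x t => deriv (fun y => f y t) x

/-- Temporal partial derivative of a function of `(x, t)`. -/
noncomputable def pdt (f : ℝ → ℝ → ℝ) : ℝ → ℝ → ℝ := fun x t => deriv (fun s => f x s) t

/-- Axial displacement from the effective inextensibility constraint:
`u(x,t) = -(1/2)∫₀ˣ w_x(ξ,t)² dξ`. -/
noncomputable def uF (w : ℝ → ℝ → ℝ) : ℝ → ℝ → ℝ := fun x t =>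
  -(1/2) * ∫ ξ in (0:ℝ)..x, (pdx w ξ t) ^ 2

/-- `u_t(x,t) = -∫₀ˣ w_x w_xt dξ`. -/
noncomputable def utF (w : ℝ → ℝ → ℝ) : ℝ → ℝ → ℝ := fun x t =>
  -∫ ξ in (0:ℝ)..x, pdx w ξ t * pdt (pdx w) ξ t

/-- `u_tt(x,t) = -∫₀ˣ [w_xt² + w_x w_xtt] dξ`. -/
noncomputable def uttF (w : ℝ → ℝ → ℝ) : ℝ → ℝ → ℝ := fun x t =>
  -∫ ξ in (0:ℝ)..x, ((pdt (pdx w) ξ t) ^ 2 + pdx w ξ t * pdt (pdt (pdx w)) ξ t)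

/-- A classical solution of the full damped inextensible cantilever system on
`[0,L] × [0,T]` with forcing `p`: smooth on an open neighborhood of `[0,L] × [0,T]`,
satisfying the PDE
`w_tt + D ∂ₓ⁴w + k₂ ∂ₓ⁴w_t − D ∂ₓ(w_xx² w_x) + D ∂ₓ²(w_x² w_xx) + ∂ₓ(w_x ∫ₓᴸ u_tt dξ) = p`
pointwise and the clamped-free boundary conditions. -/
def IsFullSol (L D k2 T : ℝ) (p w : ℝ → ℝ → ℝ) : Prop :=
  (∃ U : Set (ℝ × ℝ), IsOpen U ∧ Icc (0:ℝ) L ×ˢ Icc (0:ℝ) T ⊆ U ∧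
      ContDiffOn ℝ (⊤ : ℕ∞) (fun q : ℝ × ℝ => w q.1 q.2) U) ∧
  (∀ x ∈ Icc (0:ℝ) L, ∀ t ∈ Icc (0:ℝ) T,
      pdt (pdt w) x t + D * pdx (pdx (pdx (pdx w))) x t
        + k2 * pdx (pdx (pdx (pdx (pdt w)))) x t
        - D * pdx (fun y s => (pdx (pdx w) y s) ^ 2 * pdx w y s) x t
        + D * pdx (pdx (fun y s => (pdx w y s) ^ 2 * pdx (pdx w) y s)) x t
        + pdx (fun y s => pdx w y s * ∫ ξ in y..L, uttF w ξ s) x t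
      = p x t) ∧
  (∀ t ∈ Icc (0:ℝ) T,
    w 0 t = 0 ∧ pdx w 0 t = 0 ∧ pdx (pdx w) L t = 0 ∧ pdx (pdx (pdx w)) L t = 0)

/-- `u_xxt = -(w_xx w_xt + w_x w_xxt)` (closed pointwise form). -/
noncomputable def uxxtF (w : ℝ → ℝ → ℝ) : ℝ → ℝ → ℝ := fun x t =>
  -(pdx (pdx w) x t * pdt (pdx w) x t + pdx w x t * pdt (pdx (pdx w)) x t)

/-- `u_ttt(x,t) = -∫₀ˣ [3 w_xt w_xtt + w_x w_xttt] dξ`. -/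
noncomputable def utttF (w : ℝ → ℝ → ℝ) : ℝ → ℝ → ℝ := fun x t =>
  -∫ ξ in (0:ℝ)..x,
    (3 * pdt (pdx w) ξ t * pdt (pdt (pdx w)) ξ t
      + pdx w ξ t * pdt (pdt (pdt (pdx w))) ξ t)

/-- Level-zero energy `X₀(t) = ‖w_t‖² + ‖w_xx‖² + ‖w_x w_xx‖² + ‖u_t‖²`. -/
noncomputable def X0 (L : ℝ) (w : ℝ → ℝ → ℝ) (t : ℝ) : ℝ :=
  (∫ x in (0:ℝ)..L, (pdt w x t) ^ 2)
    + (∫ x in (0:ℝ)..L, (pdx (pdx w) x t) ^ 2)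
    + (∫ x in (0:ℝ)..L, (pdx w x t * pdx (pdx w) x t) ^ 2)
    + (∫ x in (0:ℝ)..L, (utF w x t) ^ 2)

/-- Level-one energy `X₁(t) = ‖w_tt‖² + ‖w_xxt‖² + ‖w_xt w_xx‖² + ‖w_x w_xxt‖² + ‖u_tt‖²`. -/
noncomputable def X1 (L : ℝ) (w : ℝ → ℝ → ℝ) (t : ℝ) : ℝ :=
  (∫ x in (0:ℝ)..L, (pdt (pdt w) x t) ^ 2)
    + (∫ x in (0:ℝ)..L, (pdt (pdx (pdx w)) x t) ^ 2)
    + (∫ x in (0:ℝ)..L, (pdt (pdx w) x t * pdx (pdx w) x t) ^ 2)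
    + (∫ x in (0:ℝ)..L, (pdx w x t * pdt (pdx (pdx w)) x t) ^ 2)
    + (∫ x in (0:ℝ)..L, (uttF w x t) ^ 2)

/-- Level-two energy `X₂(t) = ‖w_xxt‖² + ‖∂ₓ⁴w‖² + ‖w_x ∂ₓ⁴w‖² + ‖u_xxt‖²`. -/
noncomputable def X2 (L : ℝ) (w : ℝ → ℝ → ℝ) (t : ℝ) : ℝ :=
  (∫ x in (0:ℝ)..L, (pdt (pdx (pdx w)) x t) ^ 2)
    + (∫ x in (0:ℝ)..L, (pdx (pdx (pdx (pdx w))) x t) ^ 2)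
    + (∫ x in (0:ℝ)..L, (pdx w x t * pdx (pdx (pdx (pdx w))) x t) ^ 2)
    + (∫ x in (0:ℝ)..L, (uxxtF w x t) ^ 2)

/-- Level-three energy
`X₃(t) = ‖w_ttt‖² + ‖w_xxtt‖² + ‖w_x w_xxtt‖² + ‖w_xx w_xtt‖² + ‖u_ttt‖²`. -/
noncomputable def X3 (L : ℝ) (w : ℝ → ℝ → ℝ) (t : ℝ) : ℝ :=
  (∫ x in (0:ℝ)..L, (pdt (pdt (pdt w)) x t) ^ 2)
    + (∫ x in (0:ℝ)..L, (pdt (pdt (pdx (pdx w))) x t) ^ 2)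
    + (∫ x in (0:ℝ)..L, (pdx w x t * pdt (pdt (pdx (pdx w))) x t) ^ 2)
    + (∫ x in (0:ℝ)..L, (pdx (pdx w) x t * pdt (pdt (pdx w)) x t) ^ 2)
    + (∫ x in (0:ℝ)..L, (utttF w x t) ^ 2)

section
open MeasureTheory Set
open scoped ContDiff Topology

/-- Global smoothness of a curried function of `(x, t)`. -/
def Sm (f : ℝ → ℝ → ℝ) : Prop := ContDiff ℝ ∞ (fun q : ℝ × ℝ => f q.1 q.2)

namespace Sm

variable {f g : ℝ → ℝ → ℝ}

lemma add (hf : Sm f) (hg : Sm g) : Sm (fun x t => f x t + g x t) := ContDiff.add hf hg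
lemma sub (hf : Sm f) (hg : Sm g) : Sm (fun x t => f x t - g x t) := ContDiff.sub hf hg
lemma mul (hf : Sm f) (hg : Sm g) : Sm (fun x t => f x t * g x t) := ContDiff.mul hf hg
lemma neg (hf : Sm f) : Sm (fun x t => - f x t) := ContDiff.neg hf
lemma const (c : ℝ) : Sm (fun _ _ => c) := contDiff_const
lemma pow (hf : Sm f) (n : ℕ) : Sm (fun x t => f x t ^ n) := ContDiff.pow hf n

lemma cont (hf : Sm f) : Continuous (fun q : ℝ × ℝ => f q.1 q.2) := ContDiff.continuous hf
lemma contx (hf : Sm f) (t : ℝ) : Continuous (fun x => f x t) :=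
  hf.cont.comp (by fun_prop : Continuous fun x : ℝ => (x, t))
lemma contt (hf : Sm f) (x : ℝ) : Continuous (fun t => f x t) :=
  hf.cont.comp (by fun_prop : Continuous fun t : ℝ => (x, t))

lemma hasFDerivAt (hf : Sm f) (q : ℝ × ℝ) :
    HasFDerivAt (fun q : ℝ × ℝ => f q.1 q.2) (fderiv ℝ (fun q : ℝ × ℝ => f q.1 q.2) q) q :=
  ((ContDiff.differentiable hf (by simp)) q).hasFDerivAt

lemma hasDerivAt_x' (hf : Sm f) (x t : ℝ) :
    HasDerivAt (fun y => f y t) (fderiv ℝ (fun q : ℝ × ℝ => f q.1 q.2) (x, t) (1, 0)) x := by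
  have h := (hf.hasFDerivAt (x, t)).comp_hasDerivAt x
    ((hasDerivAt_id x).prodMk (hasDerivAt_const x t))
  exact h

lemma hasDerivAt_t' (hf : Sm f) (x t : ℝ) :
    HasDerivAt (fun s => f x s) (fderiv ℝ (fun q : ℝ × ℝ => f q.1 q.2) (x, t) (0, 1)) t := by
  have h := (hf.hasFDerivAt (x, t)).comp_hasDerivAt t
    ((hasDerivAt_const t x).prodMk (hasDerivAt_id t))
  exact h

lemma pdx_eq (hf : Sm f) (x t : ℝ) :
    _root_.pdx f x t = fderiv ℝ (fun q : ℝ × ℝ => f q.1 q.2) (x, t) (1, 0) :=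
  (hf.hasDerivAt_x' x t).deriv

lemma pdt_eq (hf : Sm f) (x t : ℝ) :
    _root_.pdt f x t = fderiv ℝ (fun q : ℝ × ℝ => f q.1 q.2) (x, t) (0, 1) :=
  (hf.hasDerivAt_t' x t).deriv

lemma dx (hf : Sm f) (x t : ℝ) : HasDerivAt (fun y => f y t) (_root_.pdx f x t) x := by
  rw [hf.pdx_eq]; exact hf.hasDerivAt_x' x t

lemma dt (hf : Sm f) (x t : ℝ) : HasDerivAt (fun s => f x s) (_root_.pdt f x t) t := by
  rw [hf.pdt_eq]; exact hf.hasDerivAt_t' x t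

lemma pdx (hf : Sm f) : Sm (_root_.pdx f) := by
  have h : (fun q : ℝ × ℝ => _root_.pdx f q.1 q.2)
      = fun q => fderiv ℝ (fun q : ℝ × ℝ => f q.1 q.2) q (1, 0) := by
    funext q; exact hf.pdx_eq q.1 q.2
  unfold Sm; rw [h]
  exact (ContDiff.fderiv_right (m := ∞) hf (by simp)).clm_apply contDiff_const

lemma pdt (hf : Sm f) : Sm (_root_.pdt f) := by
  have h : (fun q : ℝ × ℝ => _root_.pdt f q.1 q.2)
      = fun q => fderiv ℝ (fun q : ℝ × ℝ => f q.1 q.2) q (0, 1) := by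
    funext q; exact hf.pdt_eq q.1 q.2
  unfold Sm; rw [h]
  exact (ContDiff.fderiv_right (m := ∞) hf (by simp)).clm_apply contDiff_const

lemma comm (hf : Sm f) : _root_.pdx (_root_.pdt f) = _root_.pdt (_root_.pdx f) := by
  funext x t
  have hsym : IsSymmSndFDerivAt ℝ (fun q : ℝ × ℝ => f q.1 q.2) (x, t) :=
    ContDiffAt.isSymmSndFDerivAt (n := ∞) (ContDiff.contDiffAt hf) (by simp; exact WithTop.coe_le_coe.2 (le_top : (2 : ℕ∞) ≤ ⊤))
  have hd : DifferentiableAt ℝ (fderiv ℝ (fun q : ℝ × ℝ => f q.1 q.2)) (x, t) :=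
    ((ContDiff.fderiv_right (m := ∞) hf (by simp)).differentiable (by simp)) _
  rw [hf.pdt.pdx_eq, hf.pdx.pdt_eq]
  have h1 : (fun q : ℝ × ℝ => _root_.pdt f q.1 q.2)
      = fun q => fderiv ℝ (fun q : ℝ × ℝ => f q.1 q.2) q (0, 1) := by
    funext q; exact hf.pdt_eq q.1 q.2
  have h2 : (fun q : ℝ × ℝ => _root_.pdx f q.1 q.2)
      = fun q => fderiv ℝ (fun q : ℝ × ℝ => f q.1 q.2) q (1, 0) := by
    funext q; exact hf.pdx_eq q.1 q.2
  rw [h1, h2]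
  have e1 : HasFDerivAt (fun q => fderiv ℝ (fun q : ℝ × ℝ => f q.1 q.2) q (0, 1))
     _ (x, t) := hd.hasFDerivAt.clm_apply (hasFDerivAt_const ((0, 1) : ℝ × ℝ) (x, t))
  have e2 : HasFDerivAt (fun q => fderiv ℝ (fun q : ℝ × ℝ => f q.1 q.2) q (1, 0))
     _ (x, t) := hd.hasFDerivAt.clm_apply (hasFDerivAt_const ((1, 0) : ℝ × ℝ) (x, t))
  rw [e1.fderiv, e2.fderiv]
  simpa using hsym (1, 0) (0, 1)

end Sm

/-- Integration in `x` from `0`. -/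
noncomputable def Ix (f : ℝ → ℝ → ℝ) : ℝ → ℝ → ℝ := fun x t => ∫ ξ in (0:ℝ)..x, f ξ t

section
variable {f g : ℝ → ℝ → ℝ}

lemma Ix_hasDerivAt_x (hf : Sm f) (x t : ℝ) : HasDerivAt (fun y => Ix f y t) (f x t) x :=
  intervalIntegral.integral_hasDerivAt_right ((hf.contx t).intervalIntegrable _ _)
    ((hf.contx t).stronglyMeasurableAtFilter _ _) (hf.contx t).continuousAt

lemma Ix_hasDerivAt_t (hf : Sm f) (x t : ℝ) :
    HasDerivAt (fun s => Ix f x s) (Ix (pdt f) x t) t := by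
  have hc : IsCompact ((uIcc 0 x) ×ˢ (Icc (t-1) (t+1))) := isCompact_uIcc.prod isCompact_Icc
  obtain ⟨C, hC⟩ := hc.exists_bound_of_continuousOn hf.pdt.cont.continuousOn
  have := intervalIntegral.hasDerivAt_integral_of_dominated_loc_of_deriv_le (μ := volume)
    (F := fun s ξ => f ξ s) (F' := fun s ξ => pdt f ξ s) (x₀ := t) (a := 0) (b := x)
    (s := Icc (t-1) (t+1)) (bound := fun _ => C)
    (Icc_mem_nhds (by linarith) (by linarith))
    (Filter.Eventually.of_forall fun s => (hf.contx s).aestronglyMeasurable)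
    ((hf.contx t).intervalIntegrable _ _)
    ((hf.pdt.contx t).aestronglyMeasurable)
    (Filter.Eventually.of_forall fun ξ hξ s hs => hC (ξ, s) ⟨uIoc_subset_uIcc hξ, hs⟩)
    (by simp)
    (Filter.Eventually.of_forall fun ξ _ s _ => hf.dt ξ s)
  exact this.2

lemma Ix_cont (hf : Continuous (fun q : ℝ × ℝ => f q.1 q.2)) :
    Continuous (fun q : ℝ × ℝ => Ix f q.1 q.2) := by
  have := intervalIntegral.continuous_parametric_intervalIntegral_of_continuous (μ := volume)
    (a₀ := 0) (f := fun (q : ℝ × ℝ) (ξ : ℝ) => f ξ q.2) (s := fun q => q.1)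
    (by
      have : Continuous (fun p : (ℝ × ℝ) × ℝ => (p.2, p.1.2)) := by fun_prop
      exact hf.comp this) continuous_fst
  exact this

lemma Ix_hasFDerivAt (hf : Sm f) (q : ℝ × ℝ) :
    HasFDerivAt (fun q : ℝ × ℝ => Ix f q.1 q.2)
      (f q.1 q.2 • ContinuousLinearMap.fst ℝ ℝ ℝ
        + Ix (pdt f) q.1 q.2 • ContinuousLinearMap.snd ℝ ℝ ℝ) q := by
  have c1 : Continuous fun q : ℝ × ℝ => (ContinuousLinearMap.toSpanSingleton ℝ (f q.1 q.2)) :=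
    (ContinuousLinearMap.toSpanSingletonCLE (𝕜 := ℝ) (E := ℝ)).continuous.comp hf.cont
  have c2 : Continuous fun q : ℝ × ℝ =>
      (ContinuousLinearMap.toSpanSingleton ℝ (Ix (pdt f) q.1 q.2)) :=
    (ContinuousLinearMap.toSpanSingletonCLE (𝕜 := ℝ) (E := ℝ)).continuous.comp
      (Ix_cont hf.pdt.cont)
  have h := hasStrictFDerivAt_uncurry_coprod (𝕜 := ℝ) (u := q) (f := Ix f)
    (f₁ := fun x t => ContinuousLinearMap.toSpanSingleton ℝ (f x t))
    (f₂ := fun x t => ContinuousLinearMap.toSpanSingleton ℝ (Ix (pdt f) x t))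
    (Filter.Eventually.of_forall fun v => (Ix_hasDerivAt_x hf v.1 v.2).hasFDerivAt)
    (Filter.Eventually.of_forall fun v => (Ix_hasDerivAt_t hf v.1 v.2).hasFDerivAt)
    c1.continuousAt c2.continuousAt
  have e : f q.1 q.2 • ContinuousLinearMap.fst ℝ ℝ ℝ
        + Ix (pdt f) q.1 q.2 • ContinuousLinearMap.snd ℝ ℝ ℝ
      = (ContinuousLinearMap.toSpanSingleton ℝ (f q.1 q.2)).coprod
        (ContinuousLinearMap.toSpanSingleton ℝ (Ix (pdt f) q.1 q.2)) := by
    ext <;> simp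
  rw [e]
  exact h.hasFDerivAt

lemma Ix_contDiff_nat (n : ℕ) : ∀ f, Sm f → ContDiff ℝ n (fun q : ℝ × ℝ => Ix f q.1 q.2) := by
  induction n with
  | zero => intro f hf; exact contDiff_zero.2 (Ix_cont hf.cont)
  | succ n ih =>
    intro f hf
    refine contDiff_succ_iff_hasFDerivAt.2 ⟨_, ?_, Ix_hasFDerivAt hf⟩
    have h1 : ContDiff ℝ n (fun q : ℝ × ℝ => f q.1 q.2) := ContDiff.of_le hf (by exact_mod_cast le_top)
    exact (h1.smul contDiff_const).add ((ih _ hf.pdt).smul contDiff_const)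

lemma Sm.Ix (hf : Sm f) : Sm (Ix f) :=
  contDiff_infty.2 fun n => Ix_contDiff_nat n f hf

lemma pdx_Ix (hf : Sm f) : pdx (Ix f) = f := by
  funext x t; exact (Ix_hasDerivAt_x hf x t).deriv

lemma pdt_Ix (hf : Sm f) : pdt (Ix f) = Ix (pdt f) := by
  funext x t; exact (Ix_hasDerivAt_t hf x t).deriv

lemma Sm.atx (hf : Sm f) (c : ℝ) : Sm (fun _ t => f c t) := by
  have : ContDiff ℝ ∞ (fun q : ℝ × ℝ => (c, q.2)) := by fun_prop
  exact ContDiff.comp (g := fun q : ℝ × ℝ => f q.1 q.2) hf this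

lemma pdt_mul (hf : Sm f) (hg : Sm g) :
    pdt (fun x t => f x t * g x t) = fun x t => pdt f x t * g x t + f x t * pdt g x t := by
  funext x t; exact ((hf.dt x t).mul (hg.dt x t)).deriv
lemma pdt_add (hf : Sm f) (hg : Sm g) :
    pdt (fun x t => f x t + g x t) = fun x t => pdt f x t + pdt g x t := by
  funext x t; exact ((hf.dt x t).add (hg.dt x t)).deriv
lemma pdt_sub (hf : Sm f) (hg : Sm g) :
    pdt (fun x t => f x t - g x t) = fun x t => pdt f x t - pdt g x t := by
  funext x t; exact ((hf.dt x t).sub (hg.dt x t)).deriv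
lemma pdx_mul (hf : Sm f) (hg : Sm g) :
    pdx (fun x t => f x t * g x t) = fun x t => pdx f x t * g x t + f x t * pdx g x t := by
  funext x t; exact ((hf.dx x t).mul (hg.dx x t)).deriv

/-- Vanishing on `[0,T]` is inherited by the time derivative. -/
lemma pdt_zero (hf : Sm f) {T x : ℝ} (hT : 0 < T) (h : ∀ t ∈ Icc (0:ℝ) T, f x t = 0) :
    ∀ t ∈ Icc (0:ℝ) T, pdt f x t = 0 := by
  intro t ht
  have h1 : HasDerivWithinAt (fun s => f x s) (pdt f x t) (Icc 0 T) t := (hf.dt x t).hasDerivWithinAt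
  have h2 : HasDerivWithinAt (fun s => f x s) 0 (Icc 0 T) t :=
    (hasDerivWithinAt_const t (Icc 0 T) (0:ℝ)).congr (fun s hs => h s hs) (h t ht)
  exact (uniqueDiffOn_Icc hT t ht).eq_deriv _ h1 h2
end

/-- Extension of a locally smooth function to a globally smooth one. -/
lemma exists_global {U K : Set (ℝ × ℝ)} (hU : IsOpen U) (hK : IsClosed K) (hKU : K ⊆ U)
    {w : ℝ → ℝ → ℝ} (hw : ContDiffOn ℝ (⊤ : ℕ∞) (fun q : ℝ × ℝ => w q.1 q.2) U) :
    ∃ (v : ℝ → ℝ → ℝ) (V : Set (ℝ × ℝ)), Sm v ∧ IsOpen V ∧ K ⊆ V ∧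
      ∀ x t, (x, t) ∈ V → w x t = v x t := by
  obtain ⟨W, hWo, hKW, hWU⟩ := normal_exists_closure_subset hK hU hKU
  obtain ⟨χ, h1, h0, -⟩ := exists_contMDiffMap_one_nhds_of_subset_interior (n := (⊤ : ℕ∞))
    (modelWithCornersSelf ℝ (ℝ × ℝ)) (s := K) (t := W) hK (by rwa [hWo.interior_eq])
  obtain ⟨V, hVo, hKV, hV1⟩ := mem_nhdsSet_iff_exists.1 h1
  have hχ : ContDiff ℝ ∞ χ := χ.contMDiff.contDiff
  refine ⟨fun x t => χ (x, t) * w x t, V, ?_, hVo, hKV, fun x t h => ?_⟩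
  · unfold Sm
    rw [contDiff_iff_contDiffAt]
    intro q
    by_cases hq : q ∈ U
    · exact (hχ.contDiffAt).mul (hw.contDiffAt (hU.mem_nhds hq))
    · have hq' : q ∈ (closure W)ᶜ := fun h => hq (hWU h)
      have : (fun q : ℝ × ℝ => χ (q.1, q.2) * w q.1 q.2) =ᶠ[𝓝 q] fun _ => 0 := by
        filter_upwards [isClosed_closure.isOpen_compl.mem_nhds hq'] with y hy
        have : χ y = 0 := h0 y fun h => hy (subset_closure h)
        simp [this]
      exact contDiffAt_const.congr_of_eventuallyEq this
  · have : χ (x, t) = 1 := hV1 h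
    simp [this]

end

section
open MeasureTheory Set
open scoped ContDiff Topology

/-- Globally smooth solutions: the PDE is only needed at interior `x`. -/
structure GSol (L D k2 T : ℝ) (w : ℝ → ℝ → ℝ) : Prop where
  sm : Sm w
  pde : ∀ x ∈ Ioo (0:ℝ) L, ∀ t ∈ Icc (0:ℝ) T,
      pdt (pdt w) x t + D * pdx (pdx (pdx (pdx w))) x t
        + k2 * pdx (pdx (pdx (pdx (pdt w)))) x t
        - D * pdx (fun y s => (pdx (pdx w) y s) ^ 2 * pdx w y s) x t
        + D * pdx (pdx (fun y s => (pdx w y s) ^ 2 * pdx (pdx w) y s)) x t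
        + pdx (fun y s => pdx w y s * ∫ ξ in y..L, uttF w ξ s) x t = 0
  bc1 : ∀ t ∈ Icc (0:ℝ) T, w 0 t = 0
  bc2 : ∀ t ∈ Icc (0:ℝ) T, pdx w 0 t = 0
  bc3 : ∀ t ∈ Icc (0:ℝ) T, pdx (pdx w) L t = 0
  bc4 : ∀ t ∈ Icc (0:ℝ) T, pdx (pdx (pdx w)) L t = 0

/-- Equality of curried functions on a set. -/
def EqV (V : Set (ℝ × ℝ)) (f g : ℝ → ℝ → ℝ) : Prop := ∀ x t, (x, t) ∈ V → f x t = g x t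

namespace EqV
variable {V : Set (ℝ × ℝ)} {f g f' g' : ℝ → ℝ → ℝ}

lemma pdx (hV : IsOpen V) (h : EqV V f g) : EqV V (pdx f) (pdx g) := by
  intro x t hx
  apply Filter.EventuallyEq.deriv_eq
  have hc : ContinuousAt (fun y : ℝ => (y, t)) x := by fun_prop
  filter_upwards [hc.preimage_mem_nhds (hV.mem_nhds hx)] with y hy
  exact h y t hy

lemma pdt (hV : IsOpen V) (h : EqV V f g) : EqV V (pdt f) (pdt g) := by
  intro x t hx
  apply Filter.EventuallyEq.deriv_eq
  have hc : ContinuousAt (fun s : ℝ => (x, s)) t := by fun_prop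
  filter_upwards [hc.preimage_mem_nhds (hV.mem_nhds hx)] with y hy
  exact h x y hy

lemma mul (h : EqV V f g) (h' : EqV V f' g') :
    EqV V (fun x t => f x t * f' x t) (fun x t => g x t * g' x t) := by
  intro x t hx
  simp only [h x t hx, h' x t hx]

lemma sq (h : EqV V f g) : EqV V (fun x t => f x t ^ 2) (fun x t => g x t ^ 2) := by
  intro x t hx
  simp only [h x t hx]
end EqV

lemma integral_congr_box {L x y : ℝ} (hx : x ∈ Icc (0:ℝ) L) (hy : y ∈ Icc (0:ℝ) L) {f g : ℝ → ℝ}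
    (h : ∀ ξ ∈ Icc (0:ℝ) L, f ξ = g ξ) : ∫ ξ in x..y, f ξ = ∫ ξ in x..y, g ξ := by
  apply intervalIntegral.integral_congr
  intro ξ hξ
  exact h ξ ((uIcc_subset_Icc hx hy) hξ)

section transfer
variable {L D k2 T : ℝ} {w v : ℝ → ℝ → ℝ} {V : Set (ℝ × ℝ)}

lemma uttF_congr (hV : IsOpen V) (hbox : Icc (0:ℝ) L ×ˢ Icc (0:ℝ) T ⊆ V) (h : EqV V w v)
    {x t : ℝ} (hx : x ∈ Icc (0:ℝ) L) (ht : t ∈ Icc (0:ℝ) T) : uttF w x t = uttF v x t := by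
  unfold uttF
  congr 1
  refine integral_congr_box ⟨le_rfl, hx.1.trans hx.2⟩ hx fun ξ hξ => ?_
  have hm : (ξ, t) ∈ V := hbox ⟨hξ, ht⟩
  rw [((h.pdx hV).pdt hV) _ _ hm, (((h.pdx hV).pdt hV).pdt hV) _ _ hm, (h.pdx hV) _ _ hm]

lemma X_congr (hL : 0 < L) (hV : IsOpen V) (hbox : Icc (0:ℝ) L ×ˢ Icc (0:ℝ) T ⊆ V) (h : EqV V w v)
    {t : ℝ} (ht : t ∈ Icc (0:ℝ) T) :
    X0 L w t + X1 L w t + X2 L w t + X3 L w t = X0 L v t + X1 L v t + X2 L v t + X3 L v t := by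
  have hm : ∀ ξ ∈ Icc (0:ℝ) L, (ξ, t) ∈ V := fun ξ hξ => hbox ⟨hξ, ht⟩
  have h0 : (0:ℝ) ∈ Icc (0:ℝ) L := ⟨le_rfl, hL.le⟩
  have h1 : L ∈ Icc (0:ℝ) L := ⟨hL.le, le_rfl⟩
  have e1 : ∀ ξ ∈ Icc (0:ℝ) L, utF w ξ t = utF v ξ t := by
    intro x hx
    unfold utF
    congr 1
    refine integral_congr_box h0 hx fun ξ hξ => ?_
    rw [((h.pdx hV).pdt hV) _ _ (hm ξ hξ), (h.pdx hV) _ _ (hm ξ hξ)]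
  have e2 : ∀ ξ ∈ Icc (0:ℝ) L, utttF w ξ t = utttF v ξ t := by
    intro x hx
    unfold utttF
    congr 1
    refine integral_congr_box h0 hx fun ξ hξ => ?_
    rw [((h.pdx hV).pdt hV) _ _ (hm ξ hξ), (h.pdx hV) _ _ (hm ξ hξ),
      (((h.pdx hV).pdt hV).pdt hV) _ _ (hm ξ hξ), ((((h.pdx hV).pdt hV).pdt hV).pdt hV) _ _ (hm ξ hξ)]
  have e3 : ∀ ξ ∈ Icc (0:ℝ) L, uttF w ξ t = uttF v ξ t := fun x hx => uttF_congr hV hbox h hx ht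
  have i : ∀ f g : ℝ → ℝ, (∀ ξ ∈ Icc (0:ℝ) L, f ξ = g ξ) →
    ∫ ξ in (0:ℝ)..L, f ξ = ∫ ξ in (0:ℝ)..L, g ξ := fun f g hfg => integral_congr_box h0 h1 hfg
  have k0 := fun ξ hξ => (h.pdx hV) ξ t (hm ξ hξ)
  have k1 := fun ξ hξ => ((h.pdx hV).pdt hV) ξ t (hm ξ hξ)
  have k2 := fun ξ hξ => (((h.pdx hV).pdt hV).pdt hV) ξ t (hm ξ hξ)
  have l0 := fun ξ hξ => (((h.pdx hV).pdx hV)) ξ t (hm ξ hξ)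
  have l1 := fun ξ hξ => (((h.pdx hV).pdx hV).pdt hV) ξ t (hm ξ hξ)
  have l2 := fun ξ hξ => ((((h.pdx hV).pdx hV).pdt hV).pdt hV) ξ t (hm ξ hξ)
  have l4 := fun ξ hξ => ((((h.pdx hV).pdx hV).pdx hV).pdx hV) ξ t (hm ξ hξ)
  have c1 := fun ξ hξ => (h.pdt hV) ξ t (hm ξ hξ)
  have c2 := fun ξ hξ => ((h.pdt hV).pdt hV) ξ t (hm ξ hξ)
  have c3 := fun ξ hξ => (((h.pdt hV).pdt hV).pdt hV) ξ t (hm ξ hξ)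
  have a0 : X0 L w t = X0 L v t := by
    unfold X0
    congr 1
    · congr 1
      · congr 1 <;> refine i _ _ fun ξ hξ => ?_ <;> simp only [k0 ξ hξ, l0 ξ hξ, c1 ξ hξ]
      · refine i _ _ fun ξ hξ => ?_; simp only [k0 ξ hξ, l0 ξ hξ, c1 ξ hξ]
    · refine i _ _ fun ξ hξ => ?_; simp only [e1 ξ hξ]
  have a1 : X1 L w t = X1 L v t := by
    unfold X1
    refine congrArg₂ _ (congrArg₂ _ (congrArg₂ _ (congrArg₂ _ ?_ ?_) ?_) ?_) ?_ <;>
      refine i _ _ fun ξ hξ => ?_ <;>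
      simp only [k0 ξ hξ, l0 ξ hξ, c2 ξ hξ, l1 ξ hξ, k1 ξ hξ, e3 ξ hξ]
  have a2 : X2 L w t = X2 L v t := by
    unfold X2 uxxtF
    refine congrArg₂ _ (congrArg₂ _ (congrArg₂ _ ?_ ?_) ?_) ?_ <;>
      refine i _ _ fun ξ hξ => ?_ <;>
      simp only [k0 ξ hξ, l0 ξ hξ, l1 ξ hξ, k1 ξ hξ, l4 ξ hξ]
  have a3 : X3 L w t = X3 L v t := by
    unfold X3
    refine congrArg₂ _ (congrArg₂ _ (congrArg₂ _ (congrArg₂ _ ?_ ?_) ?_) ?_) ?_ <;>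
      refine i _ _ fun ξ hξ => ?_ <;>
      simp only [k0 ξ hξ, l0 ξ hξ, c3 ξ hξ, l2 ξ hξ, k2 ξ hξ, e2 ξ hξ]
  rw [a0, a1, a2, a3]

lemma GSol_of (hL : 0 < L) (hV : IsOpen V) (hbox : Icc (0:ℝ) L ×ˢ Icc (0:ℝ) T ⊆ V) (h : EqV V w v)
    (hv : Sm v) (hw : IsFullSol L D k2 T (fun _ _ => 0) w) : GSol L D k2 T v := by
  obtain ⟨-, hpde, hbc⟩ := hw
  have h0 : (0:ℝ) ∈ Icc (0:ℝ) L := ⟨le_rfl, hL.le⟩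
  have h1 : L ∈ Icc (0:ℝ) L := ⟨hL.le, le_rfl⟩
  refine ⟨hv, ?_, ?_, ?_, ?_, ?_⟩
  · intro x hx t ht
    have hxi : x ∈ Icc (0:ℝ) L := Ioo_subset_Icc_self hx
    have hm : (x, t) ∈ V := hbox ⟨hxi, ht⟩
    have := hpde x hxi t ht
    rw [((h.pdt hV).pdt hV) x t hm, ((((h.pdx hV).pdx hV).pdx hV).pdx hV) x t hm,
      (((((h.pdt hV).pdx hV).pdx hV).pdx hV).pdx hV) x t hm,
      (((((h.pdx hV).pdx hV).sq).mul (h.pdx hV)).pdx hV) x t hm,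
      (((((h.pdx hV).sq).mul ((h.pdx hV).pdx hV)).pdx hV).pdx hV) x t hm] at this
    have e : pdx (fun y s => pdx w y s * ∫ ξ in y..L, uttF w ξ s) x t
        = pdx (fun y s => pdx v y s * ∫ ξ in y..L, uttF v ξ s) x t := by
      apply Filter.EventuallyEq.deriv_eq
      filter_upwards [Ioo_mem_nhds hx.1 hx.2] with y hy
      have hy' : y ∈ Icc (0:ℝ) L := Ioo_subset_Icc_self hy
      rw [(h.pdx hV) y t (hbox ⟨hy', ht⟩)]
      congr 1
      exact integral_congr_box hy' h1 fun ξ hξ => uttF_congr hV hbox h hξ ht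
    rw [e] at this
    exact this
  · intro t ht; rw [← h 0 t (hbox ⟨h0, ht⟩)]; exact (hbc t ht).1
  · intro t ht; rw [← (h.pdx hV) 0 t (hbox ⟨h0, ht⟩)]; exact (hbc t ht).2.1
  · intro t ht; rw [← ((h.pdx hV).pdx hV) L t (hbox ⟨h1, ht⟩)]; exact (hbc t ht).2.2.1
  · intro t ht; rw [← (((h.pdx hV).pdx hV).pdx hV) L t (hbox ⟨h1, ht⟩)]; exact (hbc t ht).2.2.2
end transfer

end

section
open MeasureTheory Set
open scoped ContDiff Topology

namespace Cant

/-- `∂ₜⁿ w` -/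
noncomputable def c (n : ℕ) (w : ℝ → ℝ → ℝ) : ℝ → ℝ → ℝ := pdt^[n] w
/-- `∂ₜⁿ w_x` -/
noncomputable def p (n : ℕ) (w : ℝ → ℝ → ℝ) : ℝ → ℝ → ℝ := pdt^[n] (pdx w)
/-- `∂ₜⁿ w_xx` -/
noncomputable def P (n : ℕ) (w : ℝ → ℝ → ℝ) : ℝ → ℝ → ℝ := pdt^[n] (pdx (pdx w))
/-- `∂ₜⁿ w_xxx` -/
noncomputable def S (n : ℕ) (w : ℝ → ℝ → ℝ) : ℝ → ℝ → ℝ := pdt^[n] (pdx (pdx (pdx w)))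
/-- `∂ₜⁿ w_xxxx` -/
noncomputable def F (n : ℕ) (w : ℝ → ℝ → ℝ) : ℝ → ℝ → ℝ := pdt^[n] (pdx (pdx (pdx (pdx w))))
/-- `∂ₜⁿ u_tt` -/
noncomputable def v (n : ℕ) (w : ℝ → ℝ → ℝ) : ℝ → ℝ → ℝ := pdt^[n] (uttF w)
/-- `∂ₜⁿ ∫ₓᴸ u_tt` -/
noncomputable def m (L : ℝ) (n : ℕ) (w : ℝ → ℝ → ℝ) : ℝ → ℝ → ℝ :=
  fun x t => Ix (v n w) L t - Ix (v n w) x t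
/-- auxiliary `∫₀ˣ w_xt w_xtt` -/
noncomputable def g (w : ℝ → ℝ → ℝ) : ℝ → ℝ → ℝ := Ix (fun x t => p 1 w x t * p 2 w x t)
/-- its time derivative -/
noncomputable def g1 (w : ℝ → ℝ → ℝ) : ℝ → ℝ → ℝ :=
  Ix (fun x t => p 2 w x t * p 2 w x t + p 1 w x t * p 3 w x t)

variable {w : ℝ → ℝ → ℝ}

lemma sm_iter {f : ℝ → ℝ → ℝ} (hf : Sm f) (n : ℕ) : Sm (pdt^[n] f) := by
  induction n with
  | zero => exact hf
  | succ n ih => rw [Function.iterate_succ_apply']; exact ih.pdt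

lemma comm_iter {f : ℝ → ℝ → ℝ} (hf : Sm f) (n : ℕ) : pdx (pdt^[n] f) = pdt^[n] (pdx f) := by
  induction n with
  | zero => rfl
  | succ n ih => rw [Function.iterate_succ_apply', Function.iterate_succ_apply',
      (sm_iter hf n).comm, ih]

lemma sc (hw : Sm w) (n) : Sm (c n w) := sm_iter hw n
lemma sp (hw : Sm w) (n) : Sm (p n w) := sm_iter hw.pdx n
lemma sP (hw : Sm w) (n) : Sm (P n w) := sm_iter hw.pdx.pdx n
lemma sS (hw : Sm w) (n) : Sm (S n w) := sm_iter hw.pdx.pdx.pdx n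
lemma sF (hw : Sm w) (n) : Sm (F n w) := sm_iter hw.pdx.pdx.pdx.pdx n
lemma s_utt (hw : Sm w) : Sm (uttF w) :=
  Sm.neg (Sm.Ix (((hw.pdx.pdt).pow 2).add (hw.pdx.mul hw.pdx.pdt.pdt)))
lemma sv (hw : Sm w) (n) : Sm (v n w) := sm_iter (s_utt hw) n
lemma sm (hw : Sm w) (L n) : Sm (m L n w) := ((sv hw n).Ix.atx L).sub (sv hw n).Ix
lemma sg (hw : Sm w) : Sm (g w) := ((sp hw 1).mul (sp hw 2)).Ix
lemma sg1 (hw : Sm w) : Sm (g1 w) := (((sp hw 2).mul (sp hw 2)).add ((sp hw 1).mul (sp hw 3))).Ix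

lemma ct (hw : Sm w) (n x t) : HasDerivAt (fun s => c n w x s) (c (n+1) w x t) t := by
  have := (sc hw n).dt x t; rwa [show pdt (c n w) = c (n+1) w from (Function.iterate_succ_apply' ..).symm] at this
lemma pt (hw : Sm w) (n x t) : HasDerivAt (fun s => p n w x s) (p (n+1) w x t) t := by
  have := (sp hw n).dt x t; rwa [show pdt (p n w) = p (n+1) w from (Function.iterate_succ_apply' ..).symm] at this
lemma Pt (hw : Sm w) (n x t) : HasDerivAt (fun s => P n w x s) (P (n+1) w x t) t := by
  have := (sP hw n).dt x t; rwa [show pdt (P n w) = P (n+1) w from (Function.iterate_succ_apply' ..).symm] at this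
lemma St (hw : Sm w) (n x t) : HasDerivAt (fun s => S n w x s) (S (n+1) w x t) t := by
  have := (sS hw n).dt x t; rwa [show pdt (S n w) = S (n+1) w from (Function.iterate_succ_apply' ..).symm] at this
lemma Ft (hw : Sm w) (n x t) : HasDerivAt (fun s => F n w x s) (F (n+1) w x t) t := by
  have := (sF hw n).dt x t; rwa [show pdt (F n w) = F (n+1) w from (Function.iterate_succ_apply' ..).symm] at this
lemma vt (hw : Sm w) (n x t) : HasDerivAt (fun s => v n w x s) (v (n+1) w x t) t := by
  have := (sv hw n).dt x t; rwa [show pdt (v n w) = v (n+1) w from (Function.iterate_succ_apply' ..).symm] at this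

lemma cx (hw : Sm w) (n x t) : HasDerivAt (fun y => c n w y t) (p n w x t) x := by
  have := (sc hw n).dx x t; rwa [show pdx (c n w) = p n w from comm_iter hw n] at this
lemma px (hw : Sm w) (n x t) : HasDerivAt (fun y => p n w y t) (P n w x t) x := by
  have := (sp hw n).dx x t; rwa [show pdx (p n w) = P n w from comm_iter hw.pdx n] at this
lemma Px (hw : Sm w) (n x t) : HasDerivAt (fun y => P n w y t) (S n w x t) x := by
  have := (sP hw n).dx x t; rwa [show pdx (P n w) = S n w from comm_iter hw.pdx.pdx n] at this
lemma Sx (hw : Sm w) (n x t) : HasDerivAt (fun y => S n w y t) (F n w x t) x := by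
  have := (sS hw n).dx x t; rwa [show pdx (S n w) = F n w from comm_iter hw.pdx.pdx.pdx n] at this

lemma mt (hw : Sm w) (L n x t) : HasDerivAt (fun s => m L n w x s) (m L (n+1) w x t) t := by
  have e : pdt (v n w) = v (n+1) w := (Function.iterate_succ_apply' ..).symm
  have h1 := Ix_hasDerivAt_t (sv hw n) L t
  have h2 := Ix_hasDerivAt_t (sv hw n) x t
  rw [e] at h1 h2
  exact h1.sub h2

lemma mx (hw : Sm w) (L n x t) : HasDerivAt (fun y => m L n w y t) (- v n w x t) x := by
  have := (hasDerivAt_const x (Ix (v n w) L t)).sub (Ix_hasDerivAt_x (sv hw n) x t)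
  rw [zero_sub] at this
  exact this

lemma mL (w L n t) : m L n w L t = 0 := by simp [m]

lemma m_eq (hw : Sm w) (L x t) : m L 0 w x t = ∫ ξ in x..L, uttF w ξ t := by
  have h := (sv hw 0).contx t
  unfold m Ix
  rw [intervalIntegral.integral_interval_sub_left (h.intervalIntegrable _ _) (h.intervalIntegrable _ _)]
  rfl

lemma gt (hw : Sm w) (x t) : HasDerivAt (fun s => g w x s) (g1 w x t) t := by
  have h := Ix_hasDerivAt_t ((sp hw 1).mul (sp hw 2)) x t
  have e : pdt (fun x t => p 1 w x t * p 2 w x t)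
      = fun x t => p 2 w x t * p 2 w x t + p 1 w x t * p 3 w x t := by
    funext x t
    exact ((pt hw 1 x t).mul (pt hw 2 x t)).deriv
  rw [e] at h
  exact h

lemma v0_eq (w x t) : v 0 w x t = - Ix (fun x t => (p 1 w x t)^2 + p 0 w x t * p 2 w x t) x t := rfl

lemma v1_eq (hw : Sm w) : v 1 w = utttF w := by
  funext x t
  have h := Ix_hasDerivAt_t (((sp hw 1).pow 2).add ((sp hw 0).mul (sp hw 2))) x t
  have e : pdt (fun x t => (p 1 w x t)^2 + p 0 w x t * p 2 w x t)
      = fun x t => 3 * p 1 w x t * p 2 w x t + p 0 w x t * p 3 w x t := by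
    funext x t
    have := ((pt hw 1 x t).pow 2).add ((pt hw 0 x t).mul (pt hw 2 x t))
    refine (this.congr_deriv ?_).deriv
    simp; ring
  rw [e] at h
  have h2 := vt hw 0 x t
  exact h2.unique h.neg

/-- `∫₀ˣ w_x w_xttt` in terms of `u_ttt`. -/
lemma v1_rel (hw : Sm w) (x t) :
    Ix (fun x t => p 0 w x t * p 3 w x t) x t = - v 1 w x t - 3 * g w x t := by
  rw [v1_eq hw]
  have i1 := (((sp hw 1).mul (sp hw 2)).contx t).intervalIntegrable (μ := volume) 0 x
  have i2 := (((sp hw 0).mul (sp hw 3)).contx t).intervalIntegrable (μ := volume) 0 x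
  have : utttF w x t = -∫ ξ in (0:ℝ)..x, (3 * (p 1 w ξ t * p 2 w ξ t) + p 0 w ξ t * p 3 w ξ t) := by
    unfold utttF
    congr 1
    refine intervalIntegral.integral_congr fun ξ _ => ?_
    simp only [p, Function.iterate_succ, Function.iterate_zero, Function.comp, id]
    ring
  rw [this, intervalIntegral.integral_add (i1.const_mul 3) i2, intervalIntegral.integral_const_mul]
  simp only [Ix, g]
  ring

lemma int_zero_dt {f : ℝ → ℝ → ℝ} (hf : Sm f) {L T : ℝ} (hT : 0 < T) {f' : ℝ → ℝ → ℝ}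
    (hd : ∀ x t, HasDerivAt (fun s => f x s) (f' x t) t)
    (h0 : ∀ t ∈ Icc (0:ℝ) T, ∫ x in (0:ℝ)..L, f x t = 0) :
    Sm f' ∧ ∀ t ∈ Icc (0:ℝ) T, ∫ x in (0:ℝ)..L, f' x t = 0 := by
  have e : pdt f = f' := by funext x t; exact (hd x t).deriv
  refine ⟨e ▸ hf.pdt, ?_⟩
  intro t ht
  have := pdt_zero hf.Ix hT (x := L) h0 t ht
  rw [pdt_Ix hf, e] at this
  exact this

/-! ### Strong form -/

variable {L D k2 T : ℝ}

/-- The nonlinear remainder in expanded form. -/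
noncomputable def N (L D : ℝ) (w : ℝ → ℝ → ℝ) (x t : ℝ) : ℝ :=
  D * (P 0 w x t ^ 3 + 4 * (p 0 w x t * P 0 w x t * S 0 w x t) + p 0 w x t ^ 2 * F 0 w x t)
    + P 0 w x t * m L 0 w x t - p 0 w x t * v 0 w x t

lemma strong (h : GSol L D k2 T w) : ∀ x ∈ Ioo (0:ℝ) L, ∀ t ∈ Icc (0:ℝ) T,
    c 2 w x t + D * F 0 w x t + k2 * F 1 w x t + N L D w x t = 0 := by
  intro x hx t ht
  have hw := h.sm
  have h1 := h.pde x hx t ht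
  have e1 : pdx (pdx (pdx (pdx (pdt w)))) = F 1 w := by
    rw [hw.comm, hw.pdx.comm, hw.pdx.pdx.comm, hw.pdx.pdx.pdx.comm]; rfl
  have e2 : pdx (fun y s => (pdx (pdx w) y s) ^ 2 * pdx w y s) x t
      = 2 * P 0 w x t * S 0 w x t * p 0 w x t + P 0 w x t ^ 2 * P 0 w x t := by
    have := ((Px hw 0 x t).pow 2).mul (px hw 0 x t)
    refine (this.congr_deriv ?_).deriv
    simp
  have e3 : pdx (fun y s => (pdx w y s) ^ 2 * pdx (pdx w) y s)
      = fun x t => 2 * p 0 w x t * P 0 w x t ^ 2 + p 0 w x t ^ 2 * S 0 w x t := by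
    funext x t
    have := ((px hw 0 x t).pow 2).mul (Px hw 0 x t)
    refine (this.congr_deriv ?_).deriv
    simp; ring
  have e4 : pdx (fun x t => 2 * p 0 w x t * P 0 w x t ^ 2 + p 0 w x t ^ 2 * S 0 w x t) x t
      = 2 * P 0 w x t ^ 3 + 6 * (p 0 w x t * P 0 w x t * S 0 w x t) + p 0 w x t ^ 2 * F 0 w x t := by
    have := (((px hw 0 x t).const_mul 2).mul ((Px hw 0 x t).pow 2)).add
      (((px hw 0 x t).pow 2).mul (Sx hw 0 x t))
    refine (this.congr_deriv ?_).deriv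
    simp; ring
  have e5 : pdx (fun y s => pdx w y s * ∫ ξ in y..L, uttF w ξ s) x t
      = P 0 w x t * m L 0 w x t - p 0 w x t * v 0 w x t := by
    have e : (fun y s => pdx w y s * ∫ ξ in y..L, uttF w ξ s)
        = fun y s => p 0 w y s * m L 0 w y s := by
      funext y s; rw [m_eq hw]; rfl
    rw [e]
    have := (px hw 0 x t).mul (mx hw L 0 x t)
    refine (this.congr_deriv ?_).deriv
    ring
  rw [e1, e2, e3, e4, e5] at h1
  have e6 : pdt (pdt w) x t = c 2 w x t := rfl
  have e7 : pdx (pdx (pdx (pdx w))) x t = F 0 w x t := rfl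
  rw [e6, e7] at h1
  unfold N
  linarith

/-! ### Boundary values -/
lemma iter_zero {f : ℝ → ℝ → ℝ} (hf : Sm f) {x : ℝ} (hT : 0 < T)
    (h : ∀ t ∈ Icc (0:ℝ) T, f x t = 0) (n : ℕ) : ∀ t ∈ Icc (0:ℝ) T, pdt^[n] f x t = 0 := by
  induction n with
  | zero => exact h
  | succ n ih => rw [Function.iterate_succ_apply']; exact pdt_zero (sm_iter hf n) hT ih

lemma c_zero (h : GSol L D k2 T w) (hT : 0 < T) (n) {t} (ht : t ∈ Icc (0:ℝ) T) : c n w 0 t = 0 :=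
  iter_zero h.sm hT h.bc1 n t ht
lemma p_zero (h : GSol L D k2 T w) (hT : 0 < T) (n) {t} (ht : t ∈ Icc (0:ℝ) T) : p n w 0 t = 0 :=
  iter_zero h.sm.pdx hT h.bc2 n t ht
lemma P_L (h : GSol L D k2 T w) (hT : 0 < T) (n) {t} (ht : t ∈ Icc (0:ℝ) T) : P n w L t = 0 :=
  iter_zero h.sm.pdx.pdx hT h.bc3 n t ht
lemma S_L (h : GSol L D k2 T w) (hT : 0 < T) (n) {t} (ht : t ∈ Icc (0:ℝ) T) : S n w L t = 0 :=
  iter_zero h.sm.pdx.pdx.pdx hT h.bc4 n t ht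

/-! ### Weak form and its time derivatives -/

noncomputable def A0 (D k2 : ℝ) (w : ℝ → ℝ → ℝ) (x t : ℝ) : ℝ :=
  D * P 0 w x t + k2 * P 1 w x t + D * (p 0 w x t ^ 2 * P 0 w x t)
noncomputable def A1 (D k2 : ℝ) (w : ℝ → ℝ → ℝ) (x t : ℝ) : ℝ :=
  D * P 1 w x t + k2 * P 2 w x t
    + D * (2 * (p 0 w x t * p 1 w x t * P 0 w x t) + p 0 w x t ^ 2 * P 1 w x t)
noncomputable def A2 (D k2 : ℝ) (w : ℝ → ℝ → ℝ) (x t : ℝ) : ℝ :=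
  D * P 2 w x t + k2 * P 3 w x t
    + D * (2 * (p 1 w x t * p 1 w x t * P 0 w x t) + 2 * (p 0 w x t * p 2 w x t * P 0 w x t)
      + 4 * (p 0 w x t * p 1 w x t * P 1 w x t) + p 0 w x t ^ 2 * P 2 w x t)
noncomputable def B0 (L D : ℝ) (w : ℝ → ℝ → ℝ) (x t : ℝ) : ℝ :=
  D * (P 0 w x t ^ 2 * p 0 w x t) - p 0 w x t * m L 0 w x t
noncomputable def B1 (L D : ℝ) (w : ℝ → ℝ → ℝ) (x t : ℝ) : ℝ :=
  D * (2 * (P 0 w x t * P 1 w x t * p 0 w x t) + P 0 w x t ^ 2 * p 1 w x t)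
    - p 1 w x t * m L 0 w x t - p 0 w x t * m L 1 w x t
noncomputable def B2 (L D : ℝ) (w : ℝ → ℝ → ℝ) (x t : ℝ) : ℝ :=
  D * (2 * (P 1 w x t * P 1 w x t * p 0 w x t) + 2 * (P 0 w x t * P 2 w x t * p 0 w x t)
      + 4 * (P 0 w x t * P 1 w x t * p 1 w x t) + P 0 w x t ^ 2 * p 2 w x t)
    - p 2 w x t * m L 0 w x t - 2 * (p 1 w x t * m L 1 w x t) - p 0 w x t * m L 2 w x t

lemma sA0 (hw : Sm w) : Sm (A0 D k2 w) :=
  (((Sm.const D).mul (sP hw 0)).add ((Sm.const k2).mul (sP hw 1))).add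
    ((Sm.const D).mul (((sp hw 0).pow 2).mul (sP hw 0)))
lemma sB0 (hw : Sm w) : Sm (B0 L D w) :=
  ((Sm.const D).mul (((sP hw 0).pow 2).mul (sp hw 0))).sub ((sp hw 0).mul (sm hw L 0))

lemma A0t (hw : Sm w) (x t) : HasDerivAt (fun s => A0 D k2 w x s) (A1 D k2 w x t) t := by
  have := (((Pt hw 0 x t).const_mul D).add ((Pt hw 1 x t).const_mul k2)).add
    ((((pt hw 0 x t).pow 2).mul (Pt hw 0 x t)).const_mul D)
  refine this.congr_deriv ?_
  simp only [A1, Pi.pow_apply, Pi.mul_apply, Nat.cast_ofNat, Nat.reduceSub, pow_one, zero_add,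
    Nat.reduceAdd]
  ring
lemma A1t (hw : Sm w) (x t) : HasDerivAt (fun s => A1 D k2 w x s) (A2 D k2 w x t) t := by
  have := (((Pt hw 1 x t).const_mul D).add ((Pt hw 2 x t).const_mul k2)).add
    ((((((pt hw 0 x t).mul (pt hw 1 x t)).mul (Pt hw 0 x t)).const_mul 2).add
      (((pt hw 0 x t).pow 2).mul (Pt hw 1 x t))).const_mul D)
  refine this.congr_deriv ?_
  simp only [A2, Pi.pow_apply, Pi.mul_apply, Nat.cast_ofNat, Nat.reduceSub, pow_one, zero_add,
    Nat.reduceAdd]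
  ring
lemma B0t (hw : Sm w) (x t) : HasDerivAt (fun s => B0 L D w x s) (B1 L D w x t) t := by
  have := (((((Pt hw 0 x t).pow 2).mul (pt hw 0 x t)).const_mul D)).sub
    ((pt hw 0 x t).mul (mt hw L 0 x t))
  refine this.congr_deriv ?_
  simp only [B1, Pi.pow_apply, Pi.mul_apply, Nat.cast_ofNat, Nat.reduceSub, pow_one, zero_add,
    Nat.reduceAdd]
  ring
lemma B1t (hw : Sm w) (x t) : HasDerivAt (fun s => B1 L D w x s) (B2 L D w x t) t := by
  have := (((((((Pt hw 0 x t).mul (Pt hw 1 x t)).mul (pt hw 0 x t)).const_mul 2).add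
      (((Pt hw 0 x t).pow 2).mul (pt hw 1 x t))).const_mul D).sub
    ((pt hw 1 x t).mul (mt hw L 0 x t))).sub ((pt hw 0 x t).mul (mt hw L 1 x t))
  refine this.congr_deriv ?_
  simp only [B2, Pi.pow_apply, Pi.mul_apply, Nat.cast_ofNat, Nat.reduceSub, pow_one, zero_add,
    Nat.reduceAdd]
  ring

lemma weak0 (h : GSol L D k2 T w) (hL : 0 < L) (hT : 0 < T) {φ φ1 φ2 : ℝ → ℝ}
    (h1 : ∀ x, HasDerivAt φ (φ1 x) x) (h2 : ∀ x, HasDerivAt φ1 (φ2 x) x) (h3 : Continuous φ2)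
    (z0 : φ 0 = 0) (z1 : φ1 0 = 0) : ∀ t ∈ Icc (0:ℝ) T,
    ∫ x in (0:ℝ)..L, (c 2 w x t * φ x + A0 D k2 w x t * φ2 x + B0 L D w x t * φ1 x) = 0 := by
  intro t ht
  have hw := h.sm
  have cφ : Continuous φ := continuous_iff_continuousAt.2 fun x => (h1 x).continuousAt
  have cφ1 : Continuous φ1 := continuous_iff_continuousAt.2 fun x => (h2 x).continuousAt
  -- x-derivative of A
  let Ax : ℝ → ℝ := fun x => D * S 0 w x t + k2 * S 1 w x t
    + D * (2 * (p 0 w x t * P 0 w x t ^ 2) + p 0 w x t ^ 2 * S 0 w x t)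
  let Axx : ℝ → ℝ := fun x => D * F 0 w x t + k2 * F 1 w x t
    + D * (2 * P 0 w x t ^ 3 + 6 * (p 0 w x t * P 0 w x t * S 0 w x t) + p 0 w x t ^ 2 * F 0 w x t)
  let Bx : ℝ → ℝ := fun x => D * (2 * P 0 w x t * S 0 w x t * p 0 w x t + P 0 w x t ^ 2 * P 0 w x t)
    - (P 0 w x t * m L 0 w x t - p 0 w x t * v 0 w x t)
  have dA : ∀ x, HasDerivAt (fun y => A0 D k2 w y t) (Ax x) x := by
    intro x
    have := (((Px hw 0 x t).const_mul D).add ((Px hw 1 x t).const_mul k2)).add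
      ((((px hw 0 x t).pow 2).mul (Px hw 0 x t)).const_mul D)
    refine this.congr_deriv ?_
    simp only [Ax, Pi.pow_apply, Pi.mul_apply, Nat.cast_ofNat, Nat.reduceSub, pow_one, zero_add,
    Nat.reduceAdd]
    ring
  have dAx : ∀ x, HasDerivAt Ax (Axx x) x := by
    intro x
    have := (((Sx hw 0 x t).const_mul D).add ((Sx hw 1 x t).const_mul k2)).add
      (((((px hw 0 x t).mul ((Px hw 0 x t).pow 2)).const_mul 2).add
        (((px hw 0 x t).pow 2).mul (Sx hw 0 x t))).const_mul D)
    refine this.congr_deriv ?_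
    simp only [Axx, Pi.pow_apply, Pi.mul_apply, Nat.cast_ofNat, Nat.reduceSub, pow_one, zero_add,
    Nat.reduceAdd]
    ring
  have dB : ∀ x, HasDerivAt (fun y => B0 L D w y t) (Bx x) x := by
    intro x
    have := (((((Px hw 0 x t).pow 2).mul (px hw 0 x t)).const_mul D)).sub
      ((px hw 0 x t).mul (mx hw L 0 x t))
    refine this.congr_deriv ?_
    simp only [Bx, Pi.pow_apply, Pi.mul_apply, Nat.cast_ofNat, Nat.reduceSub, pow_one, zero_add,
    Nat.reduceAdd]
    ring
  have dG : ∀ x, HasDerivAt (fun y => A0 D k2 w y t * φ1 y - Ax y * φ y + B0 L D w y t * φ y)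
      (A0 D k2 w x t * φ2 x - Axx x * φ x + Bx x * φ x + B0 L D w x t * φ1 x) x := by
    intro x
    have := ((((dA x).mul (h2 x)).sub ((dAx x).mul (h1 x)))).add ((dB x).mul (h1 x))
    refine this.congr_deriv ?_
    ring
  have key := intervalIntegral.integral_eq_sub_of_hasDerivAt_of_le (a := 0) (b := L) hL.le
    (f := fun y => A0 D k2 w y t * φ1 y - Ax y * φ y + B0 L D w y t * φ y)
    (f' := fun x => c 2 w x t * φ x + A0 D k2 w x t * φ2 x + B0 L D w x t * φ1 x)
    (continuousOn_of_forall_continuousAt fun x _ => (dG x).continuousAt)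
    (by
      intro x hx
      refine (dG x).congr_deriv ?_
      have := strong h x hx t ht
      have e : c 2 w x t = - Axx x + Bx x := by
        simp only [Axx, Bx]; unfold N at this; linarith
      rw [e]; ring)
    (by
      apply Continuous.intervalIntegrable
      exact ((((sc hw 2).contx t).mul cφ).add (((sA0 hw).contx t).mul h3)).add
        (((sB0 hw).contx t).mul cφ1))
  rw [key]
  have b1 : A0 D k2 w L t = 0 := by simp [A0, P_L h hT _ ht]
  have b2 : Ax L = 0 := by simp [Ax, P_L h hT _ ht, S_L h hT _ ht]
  have b3 : B0 L D w L t = 0 := by simp [B0, P_L h hT _ ht, mL]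
  simp [b1, b2, b3, z0, z1]

/-- The three weak identities tested with `∂ₜ^(k) w(·,t)`. -/
lemma weak_all (h : GSol L D k2 T w) (hL : 0 < L) (hT : 0 < T) (k : ℕ) {t0 : ℝ}
    (ht0 : t0 ∈ Icc (0:ℝ) T) :
    (∀ t ∈ Icc (0:ℝ) T, ∫ x in (0:ℝ)..L, (c 2 w x t * c k w x t0
      + A0 D k2 w x t * P k w x t0 + B0 L D w x t * p k w x t0) = 0) ∧
    (∀ t ∈ Icc (0:ℝ) T, ∫ x in (0:ℝ)..L, (c 3 w x t * c k w x t0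
      + A1 D k2 w x t * P k w x t0 + B1 L D w x t * p k w x t0) = 0) ∧
    (∀ t ∈ Icc (0:ℝ) T, ∫ x in (0:ℝ)..L, (c 4 w x t * c k w x t0
      + A2 D k2 w x t * P k w x t0 + B2 L D w x t * p k w x t0) = 0) := by
  have hw := h.sm
  have fr : ∀ {f : ℝ → ℝ → ℝ}, Sm f → Sm (fun x _ => f x t0) := by
    intro f hf
    have : ContDiff ℝ ∞ (fun q : ℝ × ℝ => (q.1, t0)) := by fun_prop
    exact ContDiff.comp (g := fun q : ℝ × ℝ => f q.1 q.2) hf this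
  have w0 := weak0 h hL hT (φ := fun x => c k w x t0) (fun x => cx hw k x t0)
    (fun x => px hw k x t0) ((sP hw k).contx t0) (c_zero h hT k ht0) (p_zero h hT k ht0)
  have s0 : Sm (fun x t => c 2 w x t * c k w x t0
      + A0 D k2 w x t * P k w x t0 + B0 L D w x t * p k w x t0) :=
    (((sc hw 2).mul (fr (sc hw k))).add ((sA0 hw).mul (fr (sP hw k)))).add
      ((sB0 hw).mul (fr (sp hw k)))
  obtain ⟨s1, w1⟩ := int_zero_dt s0 hT (f' := fun x t => c 3 w x t * c k w x t0
      + A1 D k2 w x t * P k w x t0 + B1 L D w x t * p k w x t0) (fun x t =>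
      (((ct hw 2 x t).mul_const _).add ((A0t hw x t).mul_const _)).add ((B0t hw x t).mul_const _)) w0
  obtain ⟨s2, w2⟩ := int_zero_dt s1 hT (f' := fun x t => c 4 w x t * c k w x t0
      + A2 D k2 w x t * P k w x t0 + B2 L D w x t * p k w x t0) (fun x t =>
      (((ct hw 3 x t).mul_const _).add ((A1t hw x t).mul_const _)).add ((B1t hw x t).mul_const _)) w1
  exact ⟨w0, w1, w2⟩

/-- Inertia identity. -/
lemma inertia (hw : Sm w) (L t : ℝ) :
    ∫ x in (0:ℝ)..L, (p 0 w x t * m L 2 w x t * p 3 w x t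
      + v 2 w x t * (v 1 w x t + 3 * g w x t)) = 0 := by
  have hs := (sp hw 0).mul (sp hw 3)
  have d : ∀ x, HasDerivAt (fun y => m L 2 w y t * Ix (fun x t => p 0 w x t * p 3 w x t) y t)
      (p 0 w x t * m L 2 w x t * p 3 w x t + v 2 w x t * (v 1 w x t + 3 * g w x t)) x := by
    intro x
    refine ((mx hw L 2 x t).mul (Ix_hasDerivAt_x hs x t)).congr_deriv ?_
    rw [v1_rel hw]; ring
  rw [intervalIntegral.integral_eq_sub_of_hasDerivAt (fun x _ => d x)]
  · simp [mL, Ix]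
  · apply Continuous.intervalIntegrable
    exact ((((sp hw 0).mul (sm hw L 2)).mul (sp hw 3)).add
      ((sv hw 2).mul ((sv hw 1).add ((Sm.const 3).mul (sg hw))))).contx t

/-- Level-two identity. -/
lemma level2 (h : GSol L D k2 T w) (hL : 0 < L) {t : ℝ} (ht : t ∈ Icc (0:ℝ) T) :
    ∫ x in (0:ℝ)..L, (c 2 w x t + D * F 0 w x t + k2 * F 1 w x t + N L D w x t) * F 0 w x t = 0 := by
  rw [intervalIntegral.integral_of_le hL.le, integral_Ioc_eq_integral_Ioo,
    setIntegral_congr_fun (g := fun _ => (0:ℝ)) measurableSet_Ioo]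
  · simp
  · intro x hx
    simp only [strong h x hx t ht, zero_mul]

end Cant

end

section
open MeasureTheory Set
open scoped ContDiff Topology

namespace Cant
variable {w : ℝ → ℝ → ℝ} {L D k2 T : ℝ}

/-- Energy density. -/
noncomputable def eD (D k2 η : ℝ) (w : ℝ → ℝ → ℝ) (x t : ℝ) : ℝ :=
  1/2 * c 1 w x t ^ 2 + D/2 * P 0 w x t ^ 2 + 1/2 * c 2 w x t ^ 2 + D/2 * P 1 w x t ^ 2
    + 1/2 * c 3 w x t ^ 2 + D/2 * P 2 w x t ^ 2 + 1/2 * v 1 w x t ^ 2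
    + 3 * (v 1 w x t * g w x t) + η * k2 / 2 * F 0 w x t ^ 2

lemma s_eD (hw : Sm w) (η) : Sm (eD D k2 η w) :=
  ((((((((((Sm.const _).mul ((sc hw 1).pow 2))).add ((Sm.const _).mul ((sP hw 0).pow 2))).add
    ((Sm.const _).mul ((sc hw 2).pow 2))).add ((Sm.const _).mul ((sP hw 1).pow 2))).add
    ((Sm.const _).mul ((sc hw 3).pow 2))).add ((Sm.const _).mul ((sP hw 2).pow 2))).add
    ((Sm.const _).mul ((sv hw 1).pow 2))).add
    ((Sm.const _).mul ((sv hw 1).mul (sg hw)))).add ((Sm.const _).mul ((sF hw 0).pow 2))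

/-- The functional. -/
noncomputable def Phi (L D k2 η : ℝ) (w : ℝ → ℝ → ℝ) (t : ℝ) : ℝ := Ix (eD D k2 η w) L t

/-- Pointwise remainder expression. -/
def Rr (D k2 η p q r y P Q R Y S F c c2 m m1 v v1 g1 : ℝ) : ℝ :=
  - k2 * Q^2 - k2 * R^2 - k2 * Y^2
  - η * (c2 * F + D * F^2 + (D * (P^3 + 4 * (p * P * S) + p^2 * F) + P * m - p * v) * F)
  - (D * (p^2 * P) * Q + (D * (P^2 * p) - p * m) * q)
  - (D * (2 * (p * q * P) + p^2 * Q) * R + (D * (2 * (P * Q * p) + P^2 * q) - q * m - p * m1) * r)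
  - (D * (2 * (q * q * P) + 2 * (p * r * P) + 4 * (p * q * Q) + p^2 * R) * Y
    + (D * (2 * (Q * Q * p) + 2 * (P * R * p) + 4 * (P * Q * q) + P^2 * r) - r * m - 2 * (q * m1)) * y)
  + 3 * (v1 * g1) + 0 * c

/-- The remainder along a solution. -/
noncomputable def RR (L D k2 η : ℝ) (w : ℝ → ℝ → ℝ) (x t : ℝ) : ℝ :=
  Rr D k2 η (p 0 w x t) (p 1 w x t) (p 2 w x t) (p 3 w x t) (P 0 w x t) (P 1 w x t) (P 2 w x t)
    (P 3 w x t) (S 0 w x t) (F 0 w x t) (c 3 w x t) (c 2 w x t) (m L 0 w x t) (m L 1 w x t)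
    (v 0 w x t) (v 1 w x t) (g1 w x t)

lemma Phi_deriv (h : GSol L D k2 T w) (hL : 0 < L) (hT : 0 < T) (η : ℝ) {t : ℝ}
    (ht : t ∈ Icc (0:ℝ) T) :
    HasDerivAt (Phi L D k2 η w) (∫ x in (0:ℝ)..L, RR L D k2 η w x t) t := by
  have hw := h.sm
  have d0 := Ix_hasDerivAt_t (s_eD (D := D) (k2 := k2) hw η) L t
  refine d0.congr_deriv ?_
  set e' := pdt (eD D k2 η w) with he'
  have se' : Sm e' := (s_eD hw η).pdt
  have ee : ∀ x, e' x t = c 1 w x t * c 2 w x t + D * (P 0 w x t * P 1 w x t)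
      + c 2 w x t * c 3 w x t + D * (P 1 w x t * P 2 w x t) + c 3 w x t * c 4 w x t
      + D * (P 2 w x t * P 3 w x t) + v 1 w x t * v 2 w x t
      + 3 * (v 2 w x t * g w x t + v 1 w x t * g1 w x t) + η * k2 * (F 0 w x t * F 1 w x t) := by
    intro x
    have := ((((((((((ct hw 1 x t).pow 2).const_mul (1/2)).add
      (((Pt hw 0 x t).pow 2).const_mul (D/2))).add
      (((ct hw 2 x t).pow 2).const_mul (1/2))).add
      (((Pt hw 1 x t).pow 2).const_mul (D/2))).add
      (((ct hw 3 x t).pow 2).const_mul (1/2))).add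
      (((Pt hw 2 x t).pow 2).const_mul (D/2))).add
      (((vt hw 1 x t).pow 2).const_mul (1/2))).add
      (((vt hw 1 x t).mul (gt hw x t)).const_mul 3)).add
      (((Ft hw 0 x t).pow 2).const_mul (η * k2 / 2))
    refine (this.congr_deriv ?_).deriv
    simp only [Nat.cast_ofNat, Nat.reduceSub, pow_one, zero_add, Nat.reduceAdd]
    ring
  obtain ⟨w0, -, -⟩ := weak_all h hL hT 1 ht
  obtain ⟨-, w1, -⟩ := weak_all h hL hT 2 ht
  obtain ⟨-, -, w2⟩ := weak_all h hL hT 3 ht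
  replace w0 := w0 t ht
  replace w1 := w1 t ht
  replace w2 := w2 t ht
  have iner := inertia hw L t
  have l2 := level2 h hL ht
  -- continuity of the integrands
  have sA1 : Sm (A1 D k2 w) := by
    have : pdt (A0 D k2 w) = A1 D k2 w := by funext x t; exact (A0t hw x t).deriv
    exact this ▸ (sA0 hw).pdt
  have sA2 : Sm (A2 D k2 w) := by
    have : pdt (A1 D k2 w) = A2 D k2 w := by funext x t; exact (A1t hw x t).deriv
    exact this ▸ sA1.pdt
  have sB1 : Sm (B1 L D w) := by
    have : pdt (B0 L D w) = B1 L D w := by funext x t; exact (B0t hw x t).deriv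
    exact this ▸ (sB0 hw).pdt
  have sB2 : Sm (B2 L D w) := by
    have : pdt (B1 L D w) = B2 L D w := by funext x t; exact (B1t hw x t).deriv
    exact this ▸ sB1.pdt
  have sN : Sm (N L D w) :=
    (((Sm.const D).mul ((((sP hw 0).pow 3).add ((Sm.const 4).mul
      (((sp hw 0).mul (sP hw 0)).mul (sS hw 0)))).add (((sp hw 0).pow 2).mul (sF hw 0)))).add
      ((sP hw 0).mul (sm hw L 0))).sub ((sp hw 0).mul (sv hw 0))
  have i0 := ((((((sc hw 2).mul (sc hw 1))).add ((sA0 (D := D) (k2 := k2) hw).mul (sP hw 1))).add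
    ((sB0 (L := L) (D := D) hw).mul (sp hw 1))).contx t).intervalIntegrable (μ := volume) 0 L
  have i1 := ((((((sc hw 3).mul (sc hw 2))).add (sA1.mul (sP hw 2))).add
    (sB1.mul (sp hw 2))).contx t).intervalIntegrable (μ := volume) 0 L
  have i2 := ((((((sc hw 4).mul (sc hw 3))).add (sA2.mul (sP hw 3))).add
    (sB2.mul (sp hw 3))).contx t).intervalIntegrable (μ := volume) 0 L
  have i3 := (((((sp hw 0).mul (sm hw L 2)).mul (sp hw 3)).add
      ((sv hw 2).mul ((sv hw 1).add ((Sm.const 3).mul (sg hw))))).contx t).intervalIntegrable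
      (μ := volume) 0 L
  have i4 := ((((((sc hw 2).add ((Sm.const D).mul (sF hw 0))).add ((Sm.const k2).mul (sF hw 1))).add
    sN).mul (sF hw 0)).contx t).intervalIntegrable (μ := volume) 0 L
  have ie := (se'.contx t).intervalIntegrable (μ := volume) 0 L
  have tot : ∫ x in (0:ℝ)..L, RR L D k2 η w x t
      = ∫ x in (0:ℝ)..L, (e' x t
        - (c 2 w x t * c 1 w x t + A0 D k2 w x t * P 1 w x t + B0 L D w x t * p 1 w x t)
        - (c 3 w x t * c 2 w x t + A1 D k2 w x t * P 2 w x t + B1 L D w x t * p 2 w x t)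
        - (c 4 w x t * c 3 w x t + A2 D k2 w x t * P 3 w x t + B2 L D w x t * p 3 w x t)
        - (p 0 w x t * m L 2 w x t * p 3 w x t + v 2 w x t * (v 1 w x t + 3 * g w x t))
        - η * ((c 2 w x t + D * F 0 w x t + k2 * F 1 w x t + N L D w x t) * F 0 w x t)) := by
    refine intervalIntegral.integral_congr fun x _ => ?_
    simp only [ee, RR, Rr, A0, A1, A2, B0, B1, B2, N]
    ring
  rw [tot, intervalIntegral.integral_sub ((((ie.sub i0).sub i1).sub i2).sub i3) (i4.const_mul η),
    intervalIntegral.integral_sub (((ie.sub i0).sub i1).sub i2) i3,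
    intervalIntegral.integral_sub ((ie.sub i0).sub i1) i2,
    intervalIntegral.integral_sub (ie.sub i0) i1,
    intervalIntegral.integral_sub ie i0, w0, w1, w2, iner, intervalIntegral.integral_const_mul, l2]
  simp [Ix]

end Cant

end

section
open MeasureTheory Set

namespace Cant

lemma quad {K a b s s' Z x1 x2 x3 x4 : ℝ} (hK : 1 ≤ K) (ha : 0 ≤ a) (hb : 0 ≤ b) (hs : 0 ≤ s)
    (h1 : |x1| ≤ K * a) (h2 : |x2| ≤ K * b) (h3 : |x3| ≤ K * s) (h4 : |x4| ≤ K * s')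
    (hZ : s * s' ≤ Z) : |x1 * x2 * x3 * x4| ≤ K ^ 4 * (a * b * Z) := by
  have hK0 : 0 ≤ K := by linarith
  calc |x1 * x2 * x3 * x4| = |x1| * |x2| * |x3| * |x4| := by simp [abs_mul]
    _ ≤ (K * a) * (K * b) * (K * s) * (K * s') := by gcongr
    _ = K ^ 4 * (a * b * (s * s')) := by ring
    _ ≤ K ^ 4 * (a * b * Z) := by gcongr

lemma cube {K a s x1 x2 x3 : ℝ} (hK : 1 ≤ K) (ha : 0 ≤ a)
    (h1 : |x1| ≤ K * a) (h2 : |x2| ≤ K * a) (h3 : |x3| ≤ K * s) :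
    |x1 * x2 * x3| ≤ K ^ 3 * (a ^ 2 * s) := by
  have hK0 : 0 ≤ K := by linarith
  calc |x1 * x2 * x3| = |x1| * |x2| * |x3| := by simp [abs_mul]
    _ ≤ (K * a) * (K * a) * (K * s) := by gcongr
    _ = K ^ 3 * (a ^ 2 * s) := by ring

lemma young {k U Y : ℝ} (hk : 0 < k) : - (U * Y) ≤ k / 4 * Y ^ 2 + U ^ 2 / k := by
  have : k / 4 * Y ^ 2 + U ^ 2 / k + U * Y = (k * Y / 2 + U) ^ 2 / k := by field_simp; ring
  have h2 : 0 ≤ (k * Y / 2 + U) ^ 2 / k := by positivity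
  linarith

/-- the constant of the pointwise estimate -/
noncomputable def Cpt (K D k2 η : ℝ) : ℝ :=
  (17 * D + 12) * K ^ 4 + 243 * D ^ 2 * K ^ 6 / k2 + η * (2 * ((5 * D + 2) * K ^ 3) ^ 2 / D)

lemma lift_le {K : ℝ} (hK : 1 ≤ K) (x : ℝ) : |x| ≤ K * |x| := by nlinarith [abs_nonneg x]

lemma ptU {K D a p q r P Q R U : ℝ}
    (hK : 1 ≤ K) (hD : 0 < D) (ha : 0 ≤ a)
    (hp : |p| ≤ K * a) (hq : |q| ≤ K * a) (hr : |r| ≤ K * a) (hP : |P| ≤ K * a)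
    (hU : U = D * (2 * (q * q * P) + 2 * (p * r * P) + 4 * (p * q * Q) + p^2 * R))
     : |U| ≤ 9 * D * K ^ 3 * (a ^ 2 * (a + |Q| + |R|)) := by
  have hK0 : 0 ≤ K := by linarith
  have lift : ∀ x : ℝ, |x| ≤ K * |x| := lift_le hK
  ·
    have a1 := cube hK ha hq hq hP
    have a2 := cube hK ha hp hr hP
    have a3 := cube hK ha hp hq (lift Q)
    have a4 := cube hK ha hp hp (lift R)
    have : U = 2 * D * (q * q * P) + 2 * D * (p * r * P) + 4 * D * (p * q * Q) + D * (p * p * R) := by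
      rw [hU]; ring
    have b : |U| ≤ 2 * D * |q * q * P| + 2 * D * |p * r * P| + 4 * D * |p * q * Q| + D * |p * p * R| := by
      rw [this]
      refine (abs_add_le _ _).trans (add_le_add ((abs_add_le _ _).trans (add_le_add
        ((abs_add_le _ _).trans (add_le_add ?_ ?_)) ?_)) ?_)
      all_goals rw [abs_mul]; gcongr; rw [abs_of_pos (by positivity)]
    have c1 : 0 ≤ K ^ 3 * (a ^ 2 * a) := by positivity
    have c2 : 0 ≤ K ^ 3 * (a ^ 2 * |Q|) := by positivity
    have c3 : 0 ≤ K ^ 3 * (a ^ 2 * |R|) := by positivity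
    linarith [mul_le_mul_of_nonneg_left a1 hD.le, mul_le_mul_of_nonneg_left a2 hD.le,
      mul_le_mul_of_nonneg_left a3 hD.le, mul_le_mul_of_nonneg_left a4 hD.le,
      mul_nonneg hD.le c1, mul_nonneg hD.le c2, mul_nonneg hD.le c3]

lemma ptUY {K D k2 a U Q R c F Y Z : ℝ} (hK : 1 ≤ K) (hD : 0 < D) (hk : 0 < k2) (ha : 0 ≤ a)
    (hZ : Z = a^2 + Q^2 + R^2 + c^2 + F^2)
    (hUb : |U| ≤ 9 * D * K ^ 3 * (a ^ 2 * (a + |Q| + |R|)))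
     : - (U * Y) ≤ k2 / 4 * Y ^ 2 + 243 * D ^ 2 * K ^ 6 / k2 * (a ^ 4 * Z) := by
  have hK0 : 0 ≤ K := by linarith
  have sQ := sq_abs Q
  have sR := sq_abs R
  have sF' := sq_abs F
  have hU2 : U ^ 2 ≤ 243 * D ^ 2 * K ^ 6 * (a ^ 4 * Z) := by
    have e1 : U ^ 2 ≤ (9 * D * K ^ 3 * (a ^ 2 * (a + |Q| + |R|))) ^ 2 := by
      rw [← sq_abs U]; gcongr
    have e2 : (a + |Q| + |R|) ^ 2 ≤ 3 * Z := by
      rw [hZ]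
      nlinarith [sq_nonneg (a - |Q|), sq_nonneg (a - |R|), sq_nonneg (|Q| - |R|), sq_nonneg c, sq_nonneg F]
    calc _ ≤ _ := e1
      _ = 81 * D ^ 2 * K ^ 6 * (a ^ 4 * (a + |Q| + |R|) ^ 2) := by ring
      _ ≤ 81 * D ^ 2 * K ^ 6 * (a ^ 4 * (3 * Z)) := by gcongr
      _ = _ := by ring
  ·
    have := young (U := U) (Y := Y) hk
    have e : U ^ 2 / k2 ≤ 243 * D ^ 2 * K ^ 6 / k2 * (a ^ 4 * Z) := by
      rw [div_mul_eq_mul_div]; gcongr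
    linarith

lemma ptN {K D a p P S F m v N : ℝ}
    (hK : 1 ≤ K) (hD : 0 < D) (ha : 0 ≤ a)
    (hp : |p| ≤ K * a) (hP : |P| ≤ K * a) (hS : |S| ≤ K * a) (hm : |m| ≤ K * a ^ 2)
    (hv : |v| ≤ K * a ^ 2)
    (hN : N = D * (P^3 + 4 * (p * P * S) + p^2 * F) + P * m - p * v)
     : |N| ≤ (5 * D + 2) * K ^ 3 * (a ^ 2 * (a + |F|)) := by
  have hK0 : 0 ≤ K := by linarith
  have lift : ∀ x : ℝ, |x| ≤ K * |x| := lift_le hK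
  ·
    have a1 := cube hK ha hP hP hP
    have a2 := cube hK ha hp hP hS
    have a3 := cube hK ha hp hp (lift F)
    have h1a : |(1:ℝ)| * |P| ≤ K * a := by simpa using hP
    have a4 : |P * m| ≤ K ^ 3 * (a ^ 2 * a) := by
      have : |P * m| ≤ (K * a) * (K * a ^ 2) := by rw [abs_mul]; gcongr
      have hk23 : K ^ 2 ≤ K ^ 3 := pow_le_pow_right₀ hK (by norm_num)
      calc _ ≤ _ := this
        _ = K ^ 2 * (a ^ 2 * a) := by ring
        _ ≤ _ := by gcongr
    have a5 : |p * v| ≤ K ^ 3 * (a ^ 2 * a) := by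
      have : |p * v| ≤ (K * a) * (K * a ^ 2) := by rw [abs_mul]; gcongr
      have hk23 : K ^ 2 ≤ K ^ 3 := pow_le_pow_right₀ hK (by norm_num)
      calc _ ≤ _ := this
        _ = K ^ 2 * (a ^ 2 * a) := by ring
        _ ≤ _ := by gcongr
    have : N = D * (P * P * P) + 4 * D * (p * P * S) + D * (p * p * F) + P * m - p * v := by
      rw [hN]; ring
    have b : |N| ≤ D * |P * P * P| + 4 * D * |p * P * S| + D * |p * p * F| + |P * m| + |p * v| := by
      rw [this]
      refine (abs_sub _ _).trans (add_le_add ((abs_add_le _ _).trans (add_le_add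
        ((abs_add_le _ _).trans (add_le_add ((abs_add_le _ _).trans (add_le_add ?_ ?_)) ?_)) le_rfl)) le_rfl)
      all_goals rw [abs_mul]; gcongr; rw [abs_of_pos (by positivity)]
    have c1 : 0 ≤ K ^ 3 * (a ^ 2 * a) := by positivity
    have c2 : 0 ≤ K ^ 3 * (a ^ 2 * |F|) := by positivity
    linarith [mul_le_mul_of_nonneg_left a1 hD.le, mul_le_mul_of_nonneg_left a2 hD.le,
      mul_le_mul_of_nonneg_left a3 hD.le,
      mul_nonneg hD.le c1, mul_nonneg hD.le c2]

lemma ptlev {K D η a N Q R c F c2 Z : ℝ} (hK : 1 ≤ K) (hD : 0 < D) (hη : 0 < η) (ha : 0 ≤ a)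
    (hZ : Z = a^2 + Q^2 + R^2 + c^2 + F^2)
    (hNb : |N| ≤ (5 * D + 2) * K ^ 3 * (a ^ 2 * (a + |F|)))
     : - (η * (c2 * F + D * F^2 + N * F)) ≤ - (η * D / 2 * F ^ 2) + η / D * c2 ^ 2
      + η * (2 * ((5 * D + 2) * K ^ 3) ^ 2 / D) * (a ^ 4 * Z) := by
  have hK0 : 0 ≤ K := by linarith
  have sQ := sq_abs Q
  have sR := sq_abs R
  have sF' := sq_abs F
  have hN2 : N ^ 2 ≤ 2 * ((5 * D + 2) * K ^ 3) ^ 2 * (a ^ 4 * Z) := by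
    have e1 : N ^ 2 ≤ ((5 * D + 2) * K ^ 3 * (a ^ 2 * (a + |F|))) ^ 2 := by
      rw [← sq_abs N]; gcongr
    have e2 : (a + |F|) ^ 2 ≤ 2 * Z := by
      rw [hZ]
      nlinarith [sq_nonneg (a - |F|), sq_nonneg Q, sq_nonneg R, sq_nonneg c]
    calc _ ≤ _ := e1
      _ = ((5 * D + 2) * K ^ 3) ^ 2 * (a ^ 4 * (a + |F|) ^ 2) := by ring
      _ ≤ ((5 * D + 2) * K ^ 3) ^ 2 * (a ^ 4 * (2 * Z)) := by gcongr
      _ = _ := by ring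
  have hNF : - (N * F) ≤ D / 4 * F ^ 2 + 2 * ((5 * D + 2) * K ^ 3) ^ 2 / D * (a ^ 4 * Z) := by
    have := young (U := N) (Y := F) hD
    have e : N ^ 2 / D ≤ 2 * ((5 * D + 2) * K ^ 3) ^ 2 / D * (a ^ 4 * Z) := by
      rw [div_mul_eq_mul_div]; gcongr
    linarith
  have hcF : - (c2 * F) ≤ D / 4 * F ^ 2 + c2 ^ 2 / D := young hD
  ·
    have h3 : η * (-(c2 * F) - D * F ^ 2 - N * F) ≤ η * (D / 4 * F ^ 2 + c2 ^ 2 / D - D * F ^ 2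
       + (D / 4 * F ^ 2 + 2 * ((5 * D + 2) * K ^ 3) ^ 2 / D * (a ^ 4 * Z))) := by
      apply mul_le_mul_of_nonneg_left _ hη.le
      linarith
    calc _ = η * (-(c2 * F) - D * F ^ 2 - N * F) := by ring
      _ ≤ _ := h3
      _ = _ := by ring

set_option maxHeartbeats 1000000 in
lemma ptq {K D a z p q r y P Q R c F m m1 v1 g1 Z : ℝ}
    (hK : 1 ≤ K) (hD : 0 < D) (ha : 0 ≤ a) (hz : 0 ≤ z)
    (hp : |p| ≤ K * a) (hq : |q| ≤ K * a) (hr : |r| ≤ K * a) (hy : |y| ≤ K * z)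
    (hP : |P| ≤ K * a) (hm : |m| ≤ K * a ^ 2) (hm1 : |m1| ≤ K * a ^ 2)
    (hv1 : |v1| ≤ K * (a * (a + |c|))) (hg1 : |g1| ≤ K * (a * (a + z)))
    (hZ : Z = a^2 + Q^2 + R^2 + c^2 + F^2) :
    (- (D * (p^2 * P) * Q + (D * (P^2 * p) - p * m) * q) ≤ (2 * D + 1) * (K ^ 4 * (a * a * Z))) ∧
    (- (D * (2 * (p * q * P) + p^2 * Q) * R
      + (D * (2 * (P * Q * p) + P^2 * q) - q * m - p * m1) * r) ≤ (6 * D + 2) * (K ^ 4 * (a * a * Z))) ∧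
    (- ((D * (2 * (Q * Q * p) + 2 * (P * R * p) + 4 * (P * Q * q) + P^2 * r) - r * m
      - 2 * (q * m1)) * y) ≤ (9 * D + 3) * (K ^ 4 * (a * z * Z))) ∧
    (v1 * g1 ≤ K ^ 4 * (2 * (a * a * Z) + 2 * (a * z * Z))) := by
  have hK0 : 0 ≤ K := by linarith
  have hZ0 : 0 ≤ Z := by rw [hZ]; positivity
  have lift : ∀ x : ℝ, |x| ≤ K * |x| := fun x => by nlinarith [abs_nonneg x]
  have h1K : |(1:ℝ)| ≤ K * 1 := by simpa using hK
  have zaa : a * a ≤ Z := by linarith [sq_nonneg Q, sq_nonneg R, sq_nonneg c, sq_nonneg F, sq a]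
  have zaa1 : a ^ 2 * 1 ≤ Z := by linarith [sq a]
  have sQ := sq_abs Q
  have sR := sq_abs R
  have sc' := sq_abs c
  have sF' := sq_abs F
  have two : ∀ x y : ℝ, x * y ≤ (x ^ 2 + y ^ 2) / 2 := fun x y => by linarith [two_mul_le_add_sq x y]
  have n1 := sq_nonneg a
  have n2 := sq_nonneg Q
  have n3 := sq_nonneg R
  have n4 := sq_nonneg c
  have n5 := sq_nonneg F
  have zaQ : a * |Q| ≤ Z := by linarith [two a |Q|]
  have zaR : a * |R| ≤ Z := by linarith [two a |R|]
  have zac : a * |c| ≤ Z := by linarith [two a |c|]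
  have zQR : |Q| * |R| ≤ Z := by linarith [two |Q| |R|]
  have zQQ : |Q| * |Q| ≤ Z := by linarith [two |Q| |Q|]
  have z1 : (0:ℝ) ≤ 1 := zero_le_one
  have za2 : (0:ℝ) ≤ a ^ 2 := by positivity
  have aQ := abs_nonneg Q
  have aR := abs_nonneg R
  -- quartic terms of weight a * a
  have t1 := abs_le.1 (quad hK ha ha ha hp hp hP (lift Q) zaQ)
  have t2 := abs_le.1 (quad hK ha ha ha hP hP hp hq zaa)
  have t3 := abs_le.1 (quad hK ha ha za2 hp hq hm h1K zaa1)
  have t4 := abs_le.1 (quad hK ha ha ha hp hq hP (lift R) zaR)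
  have t5 := abs_le.1 (quad hK ha ha aQ hp hp (lift Q) (lift R) zQR)
  have t6 := abs_le.1 (quad hK ha ha ha hp hr hP (lift Q) zaQ)
  have t7 := abs_le.1 (quad hK ha ha ha hP hP hq hr zaa)
  have t8 := abs_le.1 (quad hK ha ha za2 hq hr hm h1K zaa1)
  have t9 := abs_le.1 (quad hK ha ha za2 hp hr hm1 h1K zaa1)
  -- quartic terms of weight a * z
  have u1 := abs_le.1 (quad hK ha hz aQ hp hy (lift Q) (lift Q) zQQ)
  have u2 := abs_le.1 (quad hK ha hz ha hp hy hP (lift R) zaR)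
  have u3 := abs_le.1 (quad hK ha hz ha hq hy hP (lift Q) zaQ)
  have u4 := abs_le.1 (quad hK ha hz ha hr hy hP hP zaa)
  have u5 := abs_le.1 (quad hK ha hz za2 hr hy hm h1K zaa1)
  have u6 := abs_le.1 (quad hK ha hz za2 hq hy hm1 h1K zaa1)
  have i1 : v1 * g1 ≤ K ^ 4 * (2 * (a * a * Z) + 2 * (a * z * Z)) := by
    have e1 : v1 * g1 ≤ |v1| * |g1| := by rw [← abs_mul]; exact le_abs_self _
    have e2 : |v1| * |g1| ≤ (K * (a * (a + |c|))) * (K * (a * (a + z))) := by gcongr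
    have e3 : (K * (a * (a + |c|))) * (K * (a * (a + z)))
        = K ^ 2 * (a * (a + |c|) * (a * a + a * z)) := by ring
    have e4 : a * (a + |c|) ≤ 2 * Z := by linarith
    have e5 : K ^ 2 * (a * (a + |c|) * (a * a + a * z)) ≤ K ^ 4 * (2 * Z * (a * a + a * z)) := by
      have : K ^ 2 ≤ K ^ 4 := pow_le_pow_right₀ hK (by norm_num)
      gcongr
    calc _ ≤ _ := e1
      _ ≤ _ := e2
      _ = _ := e3
      _ ≤ _ := e5
      _ = _ := by ring
  have q0 : - (D * (p^2 * P) * Q + (D * (P^2 * p) - p * m) * q) ≤ (2 * D + 1) * (K ^ 4 * (a * a * Z)) := by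
    linarith [mul_le_mul_of_nonneg_left t1.1 hD.le, mul_le_mul_of_nonneg_left t2.1 hD.le, t3.2]
  have q1 : - (D * (2 * (p * q * P) + p^2 * Q) * R
      + (D * (2 * (P * Q * p) + P^2 * q) - q * m - p * m1) * r) ≤ (6 * D + 2) * (K ^ 4 * (a * a * Z)) := by
    linarith [mul_le_mul_of_nonneg_left t4.1 hD.le, mul_le_mul_of_nonneg_left t5.1 hD.le,
      mul_le_mul_of_nonneg_left t6.1 hD.le, mul_le_mul_of_nonneg_left t7.1 hD.le, t8.2, t9.2]
  have q2 : - ((D * (2 * (Q * Q * p) + 2 * (P * R * p) + 4 * (P * Q * q) + P^2 * r) - r * m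
      - 2 * (q * m1)) * y) ≤ (9 * D + 3) * (K ^ 4 * (a * z * Z)) := by
    linarith [mul_le_mul_of_nonneg_left u1.1 hD.le, mul_le_mul_of_nonneg_left u2.1 hD.le,
      mul_le_mul_of_nonneg_left u3.1 hD.le, mul_le_mul_of_nonneg_left u4.1 hD.le, u5.2, u6.2]
  exact ⟨q0, q1, q2, i1⟩

lemma ptfin {K D k2 η a z Z : ℝ} (hK : 1 ≤ K) (hD : 0 < D) (hk : 0 < k2) (hη : 0 < η)
    (ha : 0 ≤ a) (hz : 0 ≤ z) (hZ0 : 0 ≤ Z) {G1 G2 : ℝ} (hG1 : G1 = K ^ 4 * (a * a * Z))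
    (hG2 : G2 = K ^ 4 * (a * z * Z))
     : (8 * D + 9) * G1 + (9 * D + 9) * G2 + 243 * D ^ 2 * K ^ 6 / k2 * (a ^ 4 * Z)
      + η * (2 * ((5 * D + 2) * K ^ 3) ^ 2 / D) * (a ^ 4 * Z)
      ≤ Cpt K D k2 η * ((a^2 + a * z + a^4) * Z) := by
  have hK0 : 0 ≤ K := by linarith
  have hG1p : 0 ≤ G1 := by rw [hG1]; positivity
  have hG2p : 0 ≤ G2 := by rw [hG2]; positivity
  ·
    have s1 : 0 ≤ 243 * D ^ 2 * K ^ 6 / k2 := by positivity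
    have s2 : 0 ≤ η * (2 * ((5 * D + 2) * K ^ 3) ^ 2 / D) := by positivity
    have r1 : 0 ≤ a ^ 2 * Z := by positivity
    have r2 : 0 ≤ a * z * Z := by positivity
    have r3 : 0 ≤ a ^ 4 * Z := by positivity
    have s3 : 0 ≤ K ^ 4 := by positivity
    have e : Cpt K D k2 η * ((a^2 + a * z + a^4) * Z)
      = (17 * D + 12) * G1 + (17 * D + 12) * G2 + (17 * D + 12) * (K ^ 4 * (a ^ 4 * Z))
        + 243 * D ^ 2 * K ^ 6 / k2 * (a ^ 2 * Z + a * z * Z + a ^ 4 * Z)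
        + η * (2 * ((5 * D + 2) * K ^ 3) ^ 2 / D) * (a ^ 2 * Z + a * z * Z + a ^ 4 * Z) := by
      rw [hG1, hG2]; unfold Cpt; ring
    rw [e]
    linarith [mul_nonneg s1 r1, mul_nonneg s1 r2, mul_nonneg s2 r1, mul_nonneg s2 r2,
      mul_nonneg s3 r3, mul_nonneg hD.le hG1p, mul_nonneg hD.le hG2p,
      mul_nonneg hD.le (mul_nonneg s3 r3)]

set_option maxHeartbeats 1000000 in
lemma pointwise {K D k2 η a z p q r y P Q R Y S F c c2 m m1 v v1 g1 : ℝ}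
    (hK : 1 ≤ K) (hD : 0 < D) (hk : 0 < k2) (hη : 0 < η) (ha : 0 ≤ a) (hz : 0 ≤ z)
    (hp : |p| ≤ K * a) (hq : |q| ≤ K * a) (hr : |r| ≤ K * a) (hy : |y| ≤ K * z)
    (hP : |P| ≤ K * a) (hS : |S| ≤ K * a) (hm : |m| ≤ K * a ^ 2) (hm1 : |m1| ≤ K * a ^ 2)
    (hv : |v| ≤ K * a ^ 2) (hv1 : |v1| ≤ K * (a * (a + |c|))) (hg1 : |g1| ≤ K * (a * (a + z))) :
    Rr D k2 η p q r y P Q R Y S F c c2 m m1 v v1 g1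
      ≤ - k2 * Q^2 - k2 * R^2 - (3/4) * k2 * Y^2 - η * D / 2 * F^2 + η / D * c2^2
        + Cpt K D k2 η * ((a^2 + a * z + a^4) * (a^2 + Q^2 + R^2 + c^2 + F^2)) := by
  obtain ⟨Z, hZ⟩ : ∃ Z, Z = a^2 + Q^2 + R^2 + c^2 + F^2 := ⟨_, rfl⟩
  have hZ0 : 0 ≤ Z := by rw [hZ]; positivity
  rw [← hZ]
  obtain ⟨q0, q1, q2, i1⟩ := ptq hK hD ha hz hp hq hr hy hP hm hm1 hv1 hg1 hZ
  have hUY := ptUY (Y := Y) hK hD hk ha hZ (ptU hK hD ha hp hq hr hP rfl)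
  have hlev := ptlev (c2 := c2) hK hD hη ha hZ (ptN hK hD ha hp hP hS hm hv rfl)
  have final := ptfin hK hD hk hη ha hz hZ0 rfl rfl
  unfold Rr
  linarith

end Cant

end

section
open MeasureTheory Set

namespace Cant
variable {w : ℝ → ℝ → ℝ} {L D k2 T : ℝ}

lemma int_abs_sq (hL : 0 < L) {f : ℝ → ℝ} (hf : Continuous f) :
    (∫ x in (0:ℝ)..L, |f x|) ^ 2 ≤ L * ∫ x in (0:ℝ)..L, f x ^ 2 := by
  set A := ∫ x in (0:ℝ)..L, |f x| with hA
  have h0 : 0 ≤ ∫ x in (0:ℝ)..L, (|f x| - A / L) ^ 2 :=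
    intervalIntegral.integral_nonneg hL.le fun x _ => sq_nonneg _
  have e : ∀ x, (|f x| - A / L) ^ 2 = f x ^ 2 - 2 * (A / L) * |f x| + (A / L) ^ 2 := by
    intro x; rw [sub_sq, sq_abs]; ring
  have i1 : IntervalIntegrable (fun x => f x ^ 2) volume 0 L := (hf.pow 2).intervalIntegrable _ _
  have i2 : IntervalIntegrable (fun x => 2 * (A / L) * |f x|) volume 0 L :=
    (continuous_const.mul hf.abs).intervalIntegrable _ _
  simp only [e] at h0
  rw [intervalIntegral.integral_add (i1.sub i2) (by simp), intervalIntegral.integral_sub i1 i2,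
    intervalIntegral.integral_const_mul, ← hA] at h0
  simp only [intervalIntegral.integral_const, sub_zero, smul_eq_mul] at h0
  have e2 : (∫ x in (0:ℝ)..L, f x ^ 2) - 2 * (A / L) * A + L * (A / L) ^ 2
      = (L * (∫ x in (0:ℝ)..L, f x ^ 2) - A ^ 2) / L := by
    field_simp; ring
  rw [e2] at h0
  rw [le_div_iff₀ hL] at h0
  linarith

lemma abs_int_le {f : ℝ → ℝ} (hf : Continuous f) {s e : ℝ} (hs : 0 ≤ s) (hse : s ≤ e)
    (he : e ≤ L) : |∫ x in s..e, f x| ≤ ∫ x in (0:ℝ)..L, |f x| := by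
  refine (intervalIntegral.abs_integral_le_integral_abs hse).trans ?_
  exact intervalIntegral.integral_mono_interval hs hse he
    (Filter.Eventually.of_forall fun x => abs_nonneg _) (hf.abs.intervalIntegrable _ _)

lemma sup0 {f f' : ℝ → ℝ} (hL : 0 < L) (hd : ∀ x, HasDerivAt f (f' x) x) (hf' : Continuous f')
    (h0 : f 0 = 0) {x : ℝ} (hx : x ∈ Icc (0:ℝ) L) : f x ^ 2 ≤ L * ∫ x in (0:ℝ)..L, f' x ^ 2 := by
  have h1 := intervalIntegral.integral_eq_sub_of_hasDerivAt (fun y _ => hd y)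
    (hf'.intervalIntegrable 0 x)
  rw [h0, sub_zero] at h1
  have h2 := abs_int_le hf' le_rfl hx.1 hx.2
  rw [h1] at h2
  calc f x ^ 2 = |f x| ^ 2 := (sq_abs _).symm
    _ ≤ _ := by gcongr
    _ ≤ _ := int_abs_sq hL hf'

lemma supL {f f' : ℝ → ℝ} (hL : 0 < L) (hd : ∀ x, HasDerivAt f (f' x) x) (hf' : Continuous f')
    (h0 : f L = 0) {x : ℝ} (hx : x ∈ Icc (0:ℝ) L) : f x ^ 2 ≤ L * ∫ x in (0:ℝ)..L, f' x ^ 2 := by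
  have h1 := intervalIntegral.integral_eq_sub_of_hasDerivAt (fun y _ => hd y)
    (hf'.intervalIntegrable x L)
  rw [h0, zero_sub] at h1
  have h2 := abs_int_le hf' hx.1 hx.2 le_rfl
  rw [h1, abs_neg] at h2
  calc f x ^ 2 = |f x| ^ 2 := (sq_abs _).symm
    _ ≤ _ := by gcongr
    _ ≤ _ := int_abs_sq hL hf'

lemma int_sq_le_of_sup (hL : 0 < L) {f : ℝ → ℝ} (hf : Continuous f) {B : ℝ}
    (h : ∀ x ∈ Icc (0:ℝ) L, f x ^ 2 ≤ B) : ∫ x in (0:ℝ)..L, f x ^ 2 ≤ L * B := by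
  have := intervalIntegral.integral_mono_on hL.le ((hf.pow 2).intervalIntegrable (μ := volume) 0 L)
    (intervalIntegrable_const (c := B)) h
  simpa using this

/-- squared norm -/
noncomputable def NN (L : ℝ) (f : ℝ → ℝ → ℝ) (t : ℝ) : ℝ := ∫ x in (0:ℝ)..L, f x t ^ 2

lemma NN_nonneg (hL : 0 < L) (f : ℝ → ℝ → ℝ) (t : ℝ) : 0 ≤ NN L f t :=
  intervalIntegral.integral_nonneg hL.le fun x _ => sq_nonneg _

/-- The total energy -/
noncomputable def XX (L : ℝ) (w : ℝ → ℝ → ℝ) (t : ℝ) : ℝ := X0 L w t + X1 L w t + X2 L w t + X3 L w t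

lemma s_ut (hw : Sm w) : Sm (utF w) := Sm.neg (Sm.Ix (hw.pdx.mul hw.pdx.pdt))
lemma s_uxxt (hw : Sm w) : Sm (uxxtF w) :=
  Sm.neg (((sP hw 0).mul (sp hw 1)).add ((sp hw 0).mul (sP hw 1)))

lemma XX_eq (hw : Sm w) (t : ℝ) : XX L w t =
    (NN L (c 1 w) t + NN L (P 0 w) t + NN L (c 2 w) t + 2 * NN L (P 1 w) t + NN L (F 0 w) t
      + NN L (c 3 w) t + NN L (P 2 w) t)
    + (NN L (fun x t => p 0 w x t * P 0 w x t) t + NN L (utF w) t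
      + NN L (fun x t => p 1 w x t * P 0 w x t) t + NN L (fun x t => p 0 w x t * P 1 w x t) t
      + NN L (v 0 w) t + NN L (fun x t => p 0 w x t * F 0 w x t) t + NN L (uxxtF w) t
      + NN L (fun x t => p 0 w x t * P 2 w x t) t + NN L (fun x t => P 0 w x t * p 2 w x t) t
      + NN L (v 1 w) t) := by
  have e : v 1 w = utttF w := v1_eq hw
  rw [e]
  have : XX L w t = (NN L (c 1 w) t + NN L (P 0 w) t + NN L (fun x t => p 0 w x t * P 0 w x t) t
     + NN L (utF w) t)
    + (NN L (c 2 w) t + NN L (P 1 w) t + NN L (fun x t => p 1 w x t * P 0 w x t) t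
      + NN L (fun x t => p 0 w x t * P 1 w x t) t + NN L (v 0 w) t)
    + (NN L (P 1 w) t + NN L (F 0 w) t + NN L (fun x t => p 0 w x t * F 0 w x t) t
      + NN L (uxxtF w) t)
    + (NN L (c 3 w) t + NN L (P 2 w) t + NN L (fun x t => p 0 w x t * P 2 w x t) t
      + NN L (fun x t => P 0 w x t * p 2 w x t) t + NN L (utttF w) t) := rfl
  rw [this]; ring

lemma NN_cont {f : ℝ → ℝ → ℝ} (hf : Sm f) : Continuous (NN L f) :=
  (Sm.contt (Sm.Ix (hf.pow 2)) L)

lemma XX_cont (hw : Sm w) : Continuous (XX L w) := by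
  have e : XX L w = _ := funext fun t => XX_eq hw t
  rw [e]
  have a1 := NN_cont (L := L) (sc hw 1)
  have a2 := NN_cont (L := L) (sP hw 0)
  have a3 := NN_cont (L := L) (sc hw 2)
  have a4 := NN_cont (L := L) (sP hw 1)
  have a5 := NN_cont (L := L) (sF hw 0)
  have a6 := NN_cont (L := L) (sc hw 3)
  have a7 := NN_cont (L := L) (sP hw 2)
  have b1 := NN_cont (L := L) ((sp hw 0).mul (sP hw 0))
  have b2 := NN_cont (L := L) (s_ut hw)
  have b3 := NN_cont (L := L) ((sp hw 1).mul (sP hw 0))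
  have b4 := NN_cont (L := L) ((sp hw 0).mul (sP hw 1))
  have b5 := NN_cont (L := L) (sv hw 0)
  have b6 := NN_cont (L := L) ((sp hw 0).mul (sF hw 0))
  have b7 := NN_cont (L := L) (s_uxxt hw)
  have b8 := NN_cont (L := L) ((sp hw 0).mul (sP hw 2))
  have b9 := NN_cont (L := L) ((sP hw 0).mul (sp hw 2))
  have b10 := NN_cont (L := L) (sv hw 1)
  fun_prop

lemma NN_le (hw : Sm w) (hL : 0 < L) (t : ℝ) :
    NN L (c 1 w) t ≤ XX L w t ∧ NN L (P 0 w) t ≤ XX L w t ∧ NN L (c 2 w) t ≤ XX L w t ∧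
    NN L (P 1 w) t ≤ XX L w t ∧ NN L (F 0 w) t ≤ XX L w t ∧ NN L (c 3 w) t ≤ XX L w t ∧
    NN L (P 2 w) t ≤ XX L w t ∧ NN L (v 1 w) t ≤ XX L w t := by
  rw [XX_eq hw]
  have h := fun f => NN_nonneg hL f t
  have a1 := h (c 1 w)
  have a2 := h (P 0 w)
  have a3 := h (c 2 w)
  have a4 := h (P 1 w)
  have a5 := h (F 0 w)
  have a6 := h (c 3 w)
  have a7 := h (P 2 w)
  have b1 := h (fun x t => p 0 w x t * P 0 w x t)
  have b2 := h (utF w)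
  have b3 := h (fun x t => p 1 w x t * P 0 w x t)
  have b4 := h (fun x t => p 0 w x t * P 1 w x t)
  have b5 := h (v 0 w)
  have b6 := h (fun x t => p 0 w x t * F 0 w x t)
  have b7 := h (uxxtF w)
  have b8 := h (fun x t => p 0 w x t * P 2 w x t)
  have b9 := h (fun x t => P 0 w x t * p 2 w x t)
  have b10 := h (v 1 w)
  refine ⟨?_, ?_, ?_, ?_, ?_, ?_, ?_, ?_⟩ <;> linarith

lemma XX_nonneg (hw : Sm w) (hL : 0 < L) (t : ℝ) : 0 ≤ XX L w t :=
  (NN_nonneg hL _ t).trans (NN_le hw hL t).1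

/-- Poincare inequalities. -/
lemma poinc (h : GSol L D k2 T w) (hL : 0 < L) (hT : 0 < T) (n : ℕ) {t : ℝ} (ht : t ∈ Icc (0:ℝ) T) :
    NN L (c n w) t ≤ L ^ 4 * NN L (P n w) t ∧ NN L (P n w) t ≤ L ^ 4 * NN L (F n w) t ∧
    NN L (S n w) t ≤ L ^ 2 * NN L (F n w) t := by
  have hw := h.sm
  have a1 : NN L (c n w) t ≤ L * (L * NN L (p n w) t) :=
    int_sq_le_of_sup hL ((sc hw n).contx t) fun x hx =>
      sup0 hL (fun x => cx hw n x t) ((sp hw n).contx t) (c_zero h hT n ht) hx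
  have a2 : NN L (p n w) t ≤ L * (L * NN L (P n w) t) :=
    int_sq_le_of_sup hL ((sp hw n).contx t) fun x hx =>
      sup0 hL (fun x => px hw n x t) ((sP hw n).contx t) (p_zero h hT n ht) hx
  have a3 : NN L (P n w) t ≤ L * (L * NN L (S n w) t) :=
    int_sq_le_of_sup hL ((sP hw n).contx t) fun x hx =>
      supL hL (fun x => Px hw n x t) ((sS hw n).contx t) (P_L h hT n ht) hx
  have a4 : NN L (S n w) t ≤ L * (L * NN L (F n w) t) :=
    int_sq_le_of_sup hL ((sS hw n).contx t) fun x hx =>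
      supL hL (fun x => Sx hw n x t) ((sF hw n).contx t) (S_L h hT n ht) hx
  have hL2 : 0 ≤ L ^ 2 := by positivity
  refine ⟨?_, ?_, ?_⟩
  · nlinarith [mul_le_mul_of_nonneg_left a2 hL2]
  · nlinarith [mul_le_mul_of_nonneg_left a4 hL2]
  · linarith

/-- Pointwise bounds at a fixed time. -/
structure Bds (K L : ℝ) (w : ℝ → ℝ → ℝ) (t a z x : ℝ) : Prop where
  p0 : |p 0 w x t| ≤ K * a
  p1 : |p 1 w x t| ≤ K * a
  p2 : |p 2 w x t| ≤ K * a
  p3 : |p 3 w x t| ≤ K * z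
  P0 : |P 0 w x t| ≤ K * a
  S0 : |S 0 w x t| ≤ K * a
  m0 : |m L 0 w x t| ≤ K * a ^ 2
  m1 : |m L 1 w x t| ≤ K * a ^ 2
  v0 : |v 0 w x t| ≤ K * a ^ 2
  v1 : |v 1 w x t| ≤ K * (a * (a + |c 3 w x t|))
  g0 : |g w x t| ≤ K * a ^ 2
  g1 : |g1 w x t| ≤ K * (a * (a + z))
  ut : |utF w x t| ≤ K * a ^ 2

lemma abs_Ix_le {f : ℝ → ℝ → ℝ} {t B : ℝ} (hB : 0 ≤ B) (h : ∀ x ∈ Icc (0:ℝ) L, |f x t| ≤ B) {x : ℝ}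
    (hx : x ∈ Icc (0:ℝ) L) : |Ix f x t| ≤ (1 + L) * B := by
  have := intervalIntegral.norm_integral_le_of_norm_le_const (a := 0) (b := x) (C := B)
    (f := fun x => f x t) (fun y hy => by
      rw [uIoc_of_le hx.1] at hy
      exact h y ⟨hy.1.le, hy.2.trans hx.2⟩)
  rw [Real.norm_eq_abs, sub_zero, abs_of_nonneg hx.1] at this
  refine this.trans ?_
  nlinarith [hx.2]

set_option maxHeartbeats 1000000 in
lemma bds (h : GSol L D k2 T w) (hL : 0 < L) (hT : 0 < T) {t : ℝ} (ht : t ∈ Icc (0:ℝ) T)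
    {a z : ℝ} (ha : 0 ≤ a) (hz : 0 ≤ z) (haX : a ^ 2 = XX L w t) (hzY : z ^ 2 = NN L (P 3 w) t) :
    ∀ x ∈ Icc (0:ℝ) L, Bds (8 * (1 + L) ^ 4) L w t a z x := by
  have hw := h.sm
  obtain ⟨l1, l2, l3, l4, l5, l6, l7, l8⟩ := NN_le hw hL t
  rw [← haX] at l1 l2 l3 l4 l5 l6 l7 l8
  obtain ⟨M, hM⟩ : ∃ M, M = 1 + L := ⟨_, rfl⟩
  have hM1 : 1 ≤ M := by linarith
  have hM0 : 0 ≤ M := by linarith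
  have hLM : L ≤ M ^ 2 := by nlinarith
  have hLM' : L ≤ M := by linarith
  have key : ∀ {y B I : ℝ}, y ^ 2 ≤ L * I → I ≤ B ^ 2 → 0 ≤ B → |y| ≤ M * B := by
    intro y B I h1 h2 h3
    apply abs_le_of_sq_le_sq _ (by positivity)
    calc y ^ 2 ≤ L * I := h1
      _ ≤ L * B ^ 2 := by gcongr
      _ ≤ M ^ 2 * B ^ 2 := by gcongr
      _ = _ := by ring
  have sp' : ∀ n, ∀ x ∈ Icc (0:ℝ) L, p n w x t ^ 2 ≤ L * NN L (P n w) t := fun n x hx =>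
    sup0 hL (fun x => px hw n x t) ((sP hw n).contx t) (p_zero h hT n ht) hx
  have b0 : ∀ x ∈ Icc (0:ℝ) L, |p 0 w x t| ≤ M * a := fun x hx => key (sp' 0 x hx) l2 ha
  have b1 : ∀ x ∈ Icc (0:ℝ) L, |p 1 w x t| ≤ M * a := fun x hx => key (sp' 1 x hx) l4 ha
  have b2 : ∀ x ∈ Icc (0:ℝ) L, |p 2 w x t| ≤ M * a := fun x hx => key (sp' 2 x hx) l7 ha
  have b3 : ∀ x ∈ Icc (0:ℝ) L, |p 3 w x t| ≤ M * z := fun x hx => key (sp' 3 x hx) hzY.ge hz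
  have bS : ∀ x ∈ Icc (0:ℝ) L, |S 0 w x t| ≤ M * a := fun x hx =>
    key (supL hL (fun x => Sx hw 0 x t) ((sF hw 0).contx t) (S_L h hT 0 ht) hx) l5 ha
  have bP : ∀ x ∈ Icc (0:ℝ) L, |P 0 w x t| ≤ M * (M * a) := fun x hx => by
    refine key (supL hL (fun x => Px hw 0 x t) ((sS hw 0).contx t) (P_L h hT 0 ht) hx) ?_
      (by positivity)
    refine ((poinc h hL hT 0 ht).2.2).trans ?_
    rw [mul_pow]
    have := NN_nonneg hL (F 0 w) t
    gcongr
  have mulb : ∀ {x y A B : ℝ}, 0 ≤ A → |x| ≤ A → |y| ≤ B → |x * y| ≤ A * B := by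
    intro x y A B hA h1 h2; rw [abs_mul]; gcongr
  have bg : ∀ x ∈ Icc (0:ℝ) L, |g w x t| ≤ M * (M * a * (M * a)) := fun x hx => by
    rw [hM]; refine abs_Ix_le (by positivity) (fun x hx => ?_) hx
    rw [← hM]; exact mulb (by positivity) (b1 x hx) (b2 x hx)
  have but : ∀ x ∈ Icc (0:ℝ) L, |utF w x t| ≤ M * (M * a * (M * a)) := fun x hx => by
    have e : utF w x t = - Ix (fun x t => p 0 w x t * p 1 w x t) x t := rfl
    rw [e, abs_neg, hM]; refine abs_Ix_le (by positivity) (fun x hx => ?_) hx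
    rw [← hM]; exact mulb (by positivity) (b0 x hx) (b1 x hx)
  have bg1 : ∀ x ∈ Icc (0:ℝ) L, |g1 w x t| ≤ M * (M * a * (M * a) + M * a * (M * z)) := fun x hx => by
    rw [hM]; refine abs_Ix_le (by positivity) (fun x hx => ?_) hx
    rw [← hM]; exact (abs_add_le _ _).trans (add_le_add (mulb (by positivity) (b2 x hx) (b2 x hx))
      (mulb (by positivity) (b1 x hx) (b3 x hx)))
  have bv0 : ∀ x ∈ Icc (0:ℝ) L, |v 0 w x t| ≤ M * (M * a * (M * a) + M * a * (M * a)) := fun x hx => by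
    rw [v0_eq, abs_neg, hM]; refine abs_Ix_le (by positivity) (fun x hx => ?_) hx
    rw [← hM, sq]; exact (abs_add_le _ _).trans (add_le_add (mulb (by positivity) (b1 x hx) (b1 x hx))
      (mulb (by positivity) (b0 x hx) (b2 x hx)))
  have cV : ∀ n, Continuous (fun x => v n w x t) := fun n => (sv hw n).contx t
  have mrep : ∀ n x, m L n w x t = ∫ ξ in x..L, v n w ξ t := fun n x => by
    unfold m Ix
    rw [intervalIntegral.integral_interval_sub_left ((cV n).intervalIntegrable _ _)
      ((cV n).intervalIntegrable _ _)]
  have mb : ∀ n, ∀ x ∈ Icc (0:ℝ) L, |m L n w x t| ≤ ∫ x in (0:ℝ)..L, |v n w x t| := fun n x hx => by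
    rw [mrep]; exact abs_int_le (cV n) hx.1 hx.2 le_rfl
  have cc3 := (sc hw 3).contx t
  have ic3 : ∫ x in (0:ℝ)..L, |c 3 w x t| ≤ M * a := by
    have := int_abs_sq hL cc3
    exact (le_abs_self _).trans (key this l6 ha)
  have bm0 : ∀ x ∈ Icc (0:ℝ) L, |m L 0 w x t| ≤ M * (M * (M * a * (M * a) + M * a * (M * a))) := by
    intro x hx
    refine (mb 0 x hx).trans ?_
    have := intervalIntegral.integral_mono_on hL.le ((cV 0).abs.intervalIntegrable (μ := volume) 0 L)
      (intervalIntegrable_const (c := M * (M * a * (M * a) + M * a * (M * a)))) bv0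
    rw [intervalIntegral.integral_const, sub_zero, smul_eq_mul] at this
    refine this.trans ?_
    gcongr
  have bv1 : ∀ x ∈ Icc (0:ℝ) L, |v 1 w x t| ≤ 4 * M ^ 3 * (a * (a + |c 3 w x t|)) := by
    intro x hx
    have r := v1_rel hw x t
    have ibp := intervalIntegral.integral_mul_deriv_eq_deriv_mul
      (u := fun x => p 0 w x t) (v := fun x => c 3 w x t) (a := 0) (b := x)
      (fun y _ => px hw 0 y t) (fun y _ => cx hw 3 y t)
      (((sP hw 0).contx t).intervalIntegrable _ _) (((sp hw 3).contx t).intervalIntegrable _ _)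
    have e : Ix (fun x t => p 0 w x t * p 3 w x t) x t
        = p 0 w x t * c 3 w x t - ∫ y in (0:ℝ)..x, P 0 w y t * c 3 w y t := by
      have := p_zero h hT 0 ht
      unfold Ix; rw [ibp, this]; ring
    have i1 : |∫ y in (0:ℝ)..x, P 0 w y t * c 3 w y t| ≤ M * (M * a) * (M * a) := by
      refine (abs_int_le (((sP hw 0).contx t).mul cc3) le_rfl hx.1 hx.2).trans ?_
      have := intervalIntegral.integral_mono_on hL.le
        ((((sP hw 0).contx t).mul cc3).abs.intervalIntegrable (μ := volume) 0 L)
        ((continuous_const.mul cc3.abs).intervalIntegrable (μ := volume) 0 L)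
        (g := fun y => M * (M * a) * |c 3 w y t|)
        (fun y hy => by
          simp only [Pi.mul_apply, abs_mul]
          exact mul_le_mul_of_nonneg_right (bP y hy) (abs_nonneg (c 3 w y t)))
      refine this.trans ?_
      rw [intervalIntegral.integral_const_mul]
      gcongr
    have i2 : |p 0 w x t * c 3 w x t| ≤ M * a * |c 3 w x t| := mulb (by positivity) (b0 x hx) le_rfl
    have i3 := bg x hx
    have e2 : v 1 w x t = - (p 0 w x t * c 3 w x t) + (∫ y in (0:ℝ)..x, P 0 w y t * c 3 w y t)
        - 3 * g w x t := by linarith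
    rw [e2]
    have t1 := abs_le.1 i1
    have t2 := abs_le.1 i2
    have t3 := abs_le.1 i3
    have q1 : M * a * |c 3 w x t| ≤ 4 * M ^ 3 * (a * |c 3 w x t|) := by
      have hm : M ≤ M ^ 3 := le_self_pow₀ hM1 (by norm_num)
      have : 0 ≤ a * |c 3 w x t| := by positivity
      nlinarith [pow_pos (show 0 < M by linarith) 3]
    rw [abs_le]; constructor <;> linarith
  have bm1 : ∀ x ∈ Icc (0:ℝ) L, |m L 1 w x t| ≤ 8 * M ^ 4 * a ^ 2 := by
    intro x hx
    refine (mb 1 x hx).trans ?_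
    have := intervalIntegral.integral_mono_on hL.le ((cV 1).abs.intervalIntegrable (μ := volume) 0 L)
      (((continuous_const.mul (continuous_const.mul (continuous_const.add cc3.abs)))).intervalIntegrable (μ := volume) 0 L)
       (g := fun x => 4 * M ^ 3 * (a * (a + |c 3 w x t|))) bv1
    rw [intervalIntegral.integral_const_mul, intervalIntegral.integral_const_mul,
      intervalIntegral.integral_add (by simp) (cc3.abs.intervalIntegrable _ _),
      intervalIntegral.integral_const, sub_zero, smul_eq_mul] at this
    refine this.trans ?_
    calc _ ≤ 4 * M ^ 3 * (a * (M * a + M * a)) := by gcongr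
      _ = _ := by ring
  intro x hx
  have pw : ∀ n ≤ 4, M ^ n ≤ M ^ 4 := fun n hn => pow_le_pow_right₀ hM1 hn
  have pM : M ≤ M ^ 4 := by simpa using pw 1 (by norm_num)
  have pM2 := pw 2 (by norm_num)
  have pM3 := pw 3 (by norm_num)
  have pM0 : 0 ≤ M ^ 4 := by positivity
  rw [← hM]
  have bc := abs_nonneg (c 3 w x t)
  have wk : ∀ s : ℝ, 0 ≤ s → M * s ≤ 8 * M ^ 4 * s := fun s hs => by
    have := mul_le_mul_of_nonneg_right pM hs
    have : 0 ≤ M ^ 4 * s := by positivity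
    linarith
  have ha2 : 0 ≤ a ^ 2 := by positivity
  have s3 := mul_le_mul_of_nonneg_right pM3 ha2
  have s4 : 0 ≤ M ^ 4 * a ^ 2 := by positivity
  constructor
  · exact (b0 x hx).trans (wk a ha)
  · exact (b1 x hx).trans (wk a ha)
  · exact (b2 x hx).trans (wk a ha)
  · exact (b3 x hx).trans (wk z hz)
  · refine (bP x hx).trans ?_
    have := mul_le_mul_of_nonneg_right pM2 ha
    have : 0 ≤ M ^ 4 * a := by positivity
    linarith
  · exact (bS x hx).trans (wk a ha)
  · refine (bm0 x hx).trans ?_; linarith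
  · exact bm1 x hx
  · refine (bv0 x hx).trans ?_; linarith
  · refine (bv1 x hx).trans ?_
    have : 4 * M ^ 3 ≤ 8 * M ^ 4 := by linarith
    gcongr
  · refine (bg x hx).trans ?_; linarith
  · refine (bg1 x hx).trans ?_
    have s5 := mul_le_mul_of_nonneg_right pM3 (mul_nonneg ha hz)
    have s6 : 0 ≤ M ^ 4 * (a * z) := by positivity
    linarith
  · refine (but x hx).trans ?_; linarith

end Cant

end

section
open MeasureTheory Set

namespace Cant
variable {w : ℝ → ℝ → ℝ} {L D k2 T : ℝ}

/-- A continuous function with given integral. -/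
def HI (L : ℝ) (h : ℝ → ℝ) (A : ℝ) : Prop := Continuous h ∧ ∫ x in (0:ℝ)..L, h x = A

lemma HI.const (L k : ℝ) : HI L (fun _ => k) (L * k) := ⟨continuous_const, by simp⟩

lemma HI.add {h : ℝ → ℝ} {A : ℝ} (H : HI L h A) {f : ℝ → ℝ → ℝ} (hf : Sm f) (t k : ℝ) :
    HI L (fun x => h x + k * f x t ^ 2) (A + k * NN L f t) := by
  have hc : Continuous (fun x => k * f x t ^ 2) := continuous_const.mul ((hf.contx t).pow 2)
  refine ⟨H.1.add hc, ?_⟩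
  rw [intervalIntegral.integral_add (H.1.intervalIntegrable _ _) (hc.intervalIntegrable _ _), H.2,
    intervalIntegral.integral_const_mul]
  rfl

lemma HI.mono (hL : 0 < L) {h h' : ℝ → ℝ} {A A' : ℝ} (H : HI L h A) (H' : HI L h' A')
    (hh : ∀ x ∈ Icc (0:ℝ) L, h x ≤ h' x) : A ≤ A' := by
  rw [← H.2, ← H'.2]
  exact intervalIntegral.integral_mono_on hL.le (H.1.intervalIntegrable _ _)
    (H'.1.intervalIntegrable _ _) hh

lemma HI.sq {f : ℝ → ℝ → ℝ} (hf : Sm f) (t : ℝ) : HI L (fun x => f x t ^ 2) (NN L f t) :=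
  ⟨(hf.contx t).pow 2, rfl⟩

/-- weight -/
noncomputable def Wt (w : ℝ → ℝ → ℝ) (a t x : ℝ) : ℝ :=
  a ^ 2 + P 1 w x t ^ 2 + P 2 w x t ^ 2 + c 3 w x t ^ 2 + F 0 w x t ^ 2

lemma NN_le_Wt (hw : Sm w) (hL : 0 < L) {a t B : ℝ} (haX : a ^ 2 = XX L w t) (hB : 0 ≤ B)
    {f : ℝ → ℝ → ℝ} (hf : Sm f) (hh : ∀ x ∈ Icc (0:ℝ) L, f x t ^ 2 ≤ B * Wt w a t x) :
    NN L f t ≤ B * ((L + 4) * XX L w t) := by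
  obtain ⟨l1, l2, l3, l4, l5, l6, l7, l8⟩ := NN_le hw hL t
  have H := ((((HI.const L (B * a ^ 2)).add (sP hw 1) t B).add (sP hw 2) t B).add (sc hw 3) t B).add
    (sF hw 0) t B
  refine (HI.mono hL (HI.sq hf t) H fun x hx => (hh x hx).trans (by unfold Wt; linarith)).trans ?_
  rw [haX]
  have := mul_le_mul_of_nonneg_left (add_le_add (add_le_add (add_le_add l4 l7) l6) l5) hB
  linarith

lemma sq_of_abs {x B : ℝ} (h : |x| ≤ B) : x ^ 2 ≤ B ^ 2 := by
  rw [← sq_abs x]; gcongr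

/-- The nonlinear part of the energy is quadratic in the energy. -/
lemma nonlin (h : GSol L D k2 T w) (hL : 0 < L) {t a z K : ℝ} (hK : 1 ≤ K)
    (haX : a ^ 2 = XX L w t)
    (hb : ∀ x ∈ Icc (0:ℝ) L, Bds K L w t a z x) :
    XX L w t ≤ (NN L (c 1 w) t + NN L (P 0 w) t + NN L (c 2 w) t + 2 * NN L (P 1 w) t
      + NN L (F 0 w) t + NN L (c 3 w) t + NN L (P 2 w) t)
      + 10 * (2 * K ^ 4 * (L + 4)) * XX L w t ^ 2 ∧
    NN L (g w) t ≤ 2 * K ^ 4 * (L + 4) * XX L w t ^ 2 := by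
  have hw := h.sm
  have hB : 0 ≤ 2 * K ^ 4 * a ^ 2 := by positivity
  have gen : ∀ f, Sm f → (∀ x ∈ Icc (0:ℝ) L, f x t ^ 2 ≤ 2 * K ^ 4 * a ^ 2 * Wt w a t x) →
      NN L f t ≤ 2 * K ^ 4 * (L + 4) * XX L w t ^ 2 := by
    intro f hf hh
    refine (NN_le_Wt hw hL haX hB hf hh).trans (le_of_eq ?_)
    rw [haX]; ring
  have k24 : K ^ 2 ≤ K ^ 4 := pow_le_pow_right₀ hK (by norm_num)
  have W0 : ∀ x, 0 ≤ Wt w a t x := fun x => by unfold Wt; positivity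
  have Wa : ∀ x, a ^ 2 ≤ Wt w a t x := fun x => by
    unfold Wt; linarith [sq_nonneg (P 1 w x t), sq_nonneg (P 2 w x t), sq_nonneg (c 3 w x t), sq_nonneg (F 0 w x t)]
  have WQ : ∀ x, a ^ 2 + P 1 w x t ^ 2 ≤ Wt w a t x := fun x => by
    unfold Wt; linarith [sq_nonneg (P 2 w x t), sq_nonneg (c 3 w x t), sq_nonneg (F 0 w x t)]
  have WR : ∀ x, P 2 w x t ^ 2 ≤ Wt w a t x := fun x => by
    unfold Wt; linarith [sq_nonneg a, sq_nonneg (P 1 w x t), sq_nonneg (c 3 w x t), sq_nonneg (F 0 w x t)]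
  have WF : ∀ x, F 0 w x t ^ 2 ≤ Wt w a t x := fun x => by
    unfold Wt; linarith [sq_nonneg a, sq_nonneg (P 1 w x t), sq_nonneg (c 3 w x t), sq_nonneg (P 2 w x t)]
  have Wc : ∀ x, a ^ 2 + c 3 w x t ^ 2 ≤ Wt w a t x := fun x => by
    unfold Wt; linarith [sq_nonneg (P 1 w x t), sq_nonneg (F 0 w x t), sq_nonneg (P 2 w x t)]
  -- product of two bounded factors
  have two : ∀ x y1 y2 : ℝ, |y1| ≤ K * a → |y2| ≤ K * a →
      (y1 * y2) ^ 2 ≤ K ^ 4 * a ^ 2 * Wt w a t x := by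
    intro x y1 y2 h1 h2
    have e1 := sq_of_abs h1
    have e2 := sq_of_abs h2
    calc (y1 * y2) ^ 2 = y1 ^ 2 * y2 ^ 2 := by ring
      _ ≤ (K * a) ^ 2 * (K * a) ^ 2 := by gcongr
      _ = K ^ 4 * a ^ 2 * a ^ 2 := by ring
      _ ≤ _ := by have := Wa x; gcongr
  have dbl : ∀ x, K ^ 4 * a ^ 2 * Wt w a t x ≤ 2 * K ^ 4 * a ^ 2 * Wt w a t x := fun x => by
    have : 0 ≤ K ^ 4 * a ^ 2 * Wt w a t x := by have := W0 x; positivity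
    linarith
  have one : ∀ x y1 y2 : ℝ, |y1| ≤ K * a → y2 ^ 2 ≤ Wt w a t x →
      (y1 * y2) ^ 2 ≤ K ^ 4 * a ^ 2 * Wt w a t x := by
    intro x y1 y2 h1 h2
    have e1 := sq_of_abs h1
    have := W0 x
    calc (y1 * y2) ^ 2 = y1 ^ 2 * y2 ^ 2 := by ring
      _ ≤ (K * a) ^ 2 * Wt w a t x := by gcongr
      _ = K ^ 2 * a ^ 2 * Wt w a t x := by ring
      _ ≤ _ := by gcongr
  have quadr : ∀ x y : ℝ, |y| ≤ K * a ^ 2 → y ^ 2 ≤ 2 * K ^ 4 * a ^ 2 * Wt w a t x := by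
    intro x y h1
    refine le_trans ?_ (dbl x)
    calc y ^ 2 ≤ (K * a ^ 2) ^ 2 := sq_of_abs h1
      _ = K ^ 2 * a ^ 2 * a ^ 2 := by ring
      _ ≤ _ := by have := Wa x; gcongr
  have b1 := gen _ ((sp hw 0).mul (sP hw 0)) fun x hx => (two x _ _ (hb x hx).p0 (hb x hx).P0).trans (dbl x)
  have b2 := gen _ (s_ut hw) fun x hx => quadr x _ (hb x hx).ut
  have b3 := gen _ ((sp hw 1).mul (sP hw 0)) fun x hx => (two x _ _ (hb x hx).p1 (hb x hx).P0).trans (dbl x)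
  have WQ' : ∀ x, P 1 w x t ^ 2 ≤ Wt w a t x := fun x => by linarith [WQ x, sq_nonneg a]
  have b4 := gen _ ((sp hw 0).mul (sP hw 1)) fun x hx => (one x _ _ (hb x hx).p0 (WQ' x)).trans (dbl x)
  have b5 := gen _ (sv hw 0) fun x hx => quadr x _ (hb x hx).v0
  have b6 := gen _ ((sp hw 0).mul (sF hw 0)) fun x hx => (one x _ _ (hb x hx).p0 (WF x)).trans (dbl x)
  have b7 := gen _ (s_uxxt hw) fun x hx => by
    have e : uxxtF w x t = -(P 0 w x t * p 1 w x t + p 0 w x t * P 1 w x t) := rfl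
    rw [e]
    have k1 := sq_of_abs (hb x hx).P0
    have k2' := sq_of_abs (hb x hx).p1
    have k3 := sq_of_abs (hb x hx).p0
    have k4 : (P 0 w x t * p 1 w x t) ^ 2 ≤ K ^ 4 * a ^ 2 * a ^ 2 := by
      calc (P 0 w x t * p 1 w x t) ^ 2 = P 0 w x t ^ 2 * p 1 w x t ^ 2 := by ring
        _ ≤ (K * a) ^ 2 * (K * a) ^ 2 := by gcongr
        _ = _ := by ring
    have k5 : (p 0 w x t * P 1 w x t) ^ 2 ≤ K ^ 4 * a ^ 2 * P 1 w x t ^ 2 := by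
      calc (p 0 w x t * P 1 w x t) ^ 2 = p 0 w x t ^ 2 * P 1 w x t ^ 2 := by ring
        _ ≤ (K * a) ^ 2 * P 1 w x t ^ 2 := by gcongr
        _ = K ^ 2 * a ^ 2 * P 1 w x t ^ 2 := by ring
        _ ≤ _ := by gcongr
    have k6 := mul_le_mul_of_nonneg_left (WQ x) hB
    have k7 := two_mul_le_add_sq (P 0 w x t * p 1 w x t) (p 0 w x t * P 1 w x t)
    linarith
  have b8 := gen _ ((sp hw 0).mul (sP hw 2)) fun x hx => (one x _ _ (hb x hx).p0 (WR x)).trans (dbl x)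
  have b9 := gen _ ((sP hw 0).mul (sp hw 2)) fun x hx => (two x _ _ (hb x hx).P0 (hb x hx).p2).trans (dbl x)
  have b10 := gen _ (sv hw 1) fun x hx => by
    have e1 := sq_of_abs (hb x hx).v1
    have e2 : (a + |c 3 w x t|) ^ 2 ≤ 2 * Wt w a t x := by
      have := two_mul_le_add_sq a |c 3 w x t|
      have := sq_abs (c 3 w x t)
      have := Wc x
      linarith
    have := W0 x
    calc v 1 w x t ^ 2 ≤ _ := e1
      _ = K ^ 2 * a ^ 2 * (a + |c 3 w x t|) ^ 2 := by ring
      _ ≤ K ^ 4 * a ^ 2 * (2 * Wt w a t x) := by gcongr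
      _ = _ := by ring
  have b11 := gen _ (sg hw) fun x hx => quadr x _ (hb x hx).g0
  refine ⟨?_, b11⟩
  have := XX_eq (L := L) hw t
  linarith

lemma Phi_lower (hw : Sm w) (hL : 0 < L) (hD : 0 < D) (η t : ℝ) :
    D / 2 * NN L (P 1 w) t + D / 2 * NN L (P 2 w) t + 1 / 2 * NN L (c 3 w) t
      + η * k2 / 2 * NN L (F 0 w) t - 9 / 2 * NN L (g w) t ≤ Phi L D k2 η w t := by
  have H := (((((HI.const L 0).add (sP hw 1) t (D / 2)).add (sP hw 2) t (D / 2)).add (sc hw 3) t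
    (1 / 2)).add (sF hw 0) t (η * k2 / 2)).add (sg hw) t (- (9 / 2))
  have H' : HI L (fun x => eD D k2 η w x t) (Phi L D k2 η w t) := ⟨(s_eD hw η).contx t, rfl⟩
  have := HI.mono hL H H' fun x hx => by
    unfold eD
    have h1 : 0 ≤ (v 1 w x t + 3 * g w x t) ^ 2 := sq_nonneg _
    have h2 : 0 ≤ c 1 w x t ^ 2 := sq_nonneg _
    have h3 : 0 ≤ c 2 w x t ^ 2 := sq_nonneg _
    have h4 : 0 ≤ D * P 0 w x t ^ 2 := by positivity
    linarith
  linarith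

lemma Phi_upper (hw : Sm w) (hL : 0 < L) (hD : 0 < D) (hk : 0 < k2) {η : ℝ} (hη : 0 < η) (t : ℝ) :
    Phi L D k2 η w t ≤ (5 / 2 + 3 * D / 2 + η * k2 / 2) * XX L w t + 9 / 2 * NN L (g w) t := by
  have H := (((((((((HI.const L 0).add (sc hw 1) t (1 / 2)).add (sP hw 0) t (D / 2)).add (sc hw 2) t
    (1 / 2)).add (sP hw 1) t (D / 2)).add (sc hw 3) t (1 / 2)).add (sP hw 2) t (D / 2)).add
    (sv hw 1) t 1).add (sg hw) t (9 / 2)).add (sF hw 0) t (η * k2 / 2)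
  have H' : HI L (fun x => eD D k2 η w x t) (Phi L D k2 η w t) := ⟨(s_eD hw η).contx t, rfl⟩
  have := HI.mono hL H' H fun x hx => by
    unfold eD
    have h1 : 0 ≤ (v 1 w x t - 3 * g w x t) ^ 2 := sq_nonneg _
    linarith
  obtain ⟨l1, l2, l3, l4, l5, l6, l7, l8⟩ := NN_le hw hL t
  have d1 := mul_le_mul_of_nonneg_left l2 hD.le
  have d2 := mul_le_mul_of_nonneg_left l4 hD.le
  have d3 := mul_le_mul_of_nonneg_left l7 hD.le
  have d4 := mul_le_mul_of_nonneg_left l5 (mul_pos hη hk).le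
  linarith

lemma s_RR (hw : Sm w) (η t : ℝ) : Continuous (fun x => RR L D k2 η w x t) := by
  have a1 := (sp hw 0).contx t
  have a2 := (sp hw 1).contx t
  have a3 := (sp hw 2).contx t
  have a4 := (sp hw 3).contx t
  have b1 := (sP hw 0).contx t
  have b2 := (sP hw 1).contx t
  have b3 := (sP hw 2).contx t
  have b4 := (sP hw 3).contx t
  have c1 := (sS hw 0).contx t
  have c2 := (sF hw 0).contx t
  have c3 := (sc hw 3).contx t
  have c4 := (sc hw 2).contx t
  have d1 := (sm hw L 0).contx t
  have d2 := (sm hw L 1).contx t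
  have d3 := (sv hw 0).contx t
  have d4 := (sv hw 1).contx t
  have d5 := (sg1 hw).contx t
  unfold RR Rr
  fun_prop

lemma Rint (h : GSol L D k2 T w) (hL : 0 < L) (hD : 0 < D) (hk : 0 < k2)
    {η : ℝ} (hη : 0 < η) {t a z K : ℝ} (ha : 0 ≤ a) (hz : 0 ≤ z) (hK : 1 ≤ K)
    (haX : a ^ 2 = XX L w t) (hzY : z ^ 2 = NN L (P 3 w) t)
    (hb : ∀ x ∈ Icc (0:ℝ) L, Bds K L w t a z x) :
    (∫ x in (0:ℝ)..L, RR L D k2 η w x t) ≤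
      - k2 * NN L (P 1 w) t - k2 * NN L (P 2 w) t - k2 / 2 * NN L (P 3 w) t
      - η * D / 2 * NN L (F 0 w) t + η / D * NN L (c 2 w) t
      + Cpt K D k2 η * (L + 4) * XX L w t ^ 2
      + (Cpt K D k2 η * (L + 4) + (Cpt K D k2 η * (L + 4)) ^ 2 / k2) * XX L w t ^ 3 := by
  have hw := h.sm
  have hC : 0 ≤ Cpt K D k2 η := by unfold Cpt; positivity
  obtain ⟨C, hCe⟩ : ∃ C, C = Cpt K D k2 η := ⟨_, rfl⟩
  rw [← hCe] at hC ⊢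
  obtain ⟨B, hB⟩ : ∃ B, B = C * (a ^ 2 + a * z + a ^ 4) := ⟨_, rfl⟩
  have hB0 : 0 ≤ B := by rw [hB]; positivity
  have H := ((((((HI.const L (B * a ^ 2)).add (sP hw 1) t (B - k2)).add (sP hw 2) t (B - k2)).add
    (sP hw 3) t (- (3 / 4 * k2))).add (sF hw 0) t (B - η * D / 2)).add (sc hw 2) t (η / D)).add
    (sc hw 3) t B
  have H' : HI L (fun x => RR L D k2 η w x t) (∫ x in (0:ℝ)..L, RR L D k2 η w x t) :=
    ⟨s_RR hw η t, rfl⟩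
  have key := HI.mono hL H' H fun x hx => by
    have b := hb x hx
    have := pointwise (Q := P 1 w x t) (R := P 2 w x t) (Y := P 3 w x t) (F := F 0 w x t)
      (c2 := c 2 w x t) hK hD hk hη ha hz b.p0 b.p1 b.p2 b.p3 b.P0 b.S0 b.m0 b.m1 b.v0 b.v1 b.g1
    rw [← hCe] at this
    refine this.trans (le_of_eq ?_)
    rw [hB]; ring
  obtain ⟨l1, l2, l3, l4, l5, l6, l7, l8⟩ := NN_le hw hL t
  have m1 := mul_le_mul_of_nonneg_left (add_le_add (add_le_add (add_le_add l4 l7) l6) l5) hB0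
  have y := young (k := k2) (U := -(C * (L + 4) * a * a ^ 2)) (Y := z) hk
  have e1 : B * ((L + 4) * a ^ 2) = C * (L + 4) * XX L w t ^ 2 + C * (L + 4) * XX L w t ^ 3
      + C * (L + 4) * a * a ^ 2 * z := by
    rw [hB, ← haX]; ring
  have e2 : (-(C * (L + 4) * a * a ^ 2)) ^ 2 / k2 = (C * (L + 4)) ^ 2 / k2 * XX L w t ^ 3 := by
    rw [← haX]; ring
  rw [e2] at y
  rw [← haX] at m1 
  rw [← hzY] at key ⊢
  linarith

end Cant

end

section
open MeasureTheory Set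

namespace Cant

set_option maxHeartbeats 1000000 in
lemma main_ineq (L D k2 : ℝ) (hL : 0 < L) (hD : 0 < D) (hk : 0 < k2) :
    ∃ η κ C A B : ℝ, 0 < κ ∧ 0 < C ∧ 0 < A ∧ 0 < B ∧ ∀ T : ℝ, 0 < T → ∀ w, GSol L D k2 T w →
      ∀ t ∈ Icc (0:ℝ) T,
        (∫ x in (0:ℝ)..L, RR L D k2 η w x t)
          ≤ - κ * XX L w t + C * (XX L w t ^ 2 + XX L w t ^ 3) ∧
        XX L w t ≤ A * Phi L D k2 η w t + A * B * XX L w t ^ 2 ∧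
        Phi L D k2 η w t ≤ B * XX L w t + B * XX L w t ^ 2 := by
  obtain ⟨η, hηe⟩ : ∃ η, η = k2 * D / (2 * (1 + L ^ 4)) := ⟨_, rfl⟩
  have hη : 0 < η := by rw [hηe]; positivity
  have hL4 : 0 < L ^ 4 := by positivity
  have hη2 : η / D * L ^ 4 ≤ k2 / 2 := by
    have : η / D * L ^ 4 = k2 / 2 * (L ^ 4 / (1 + L ^ 4)) := by rw [hηe]; field_simp
    rw [this]
    have h1 : L ^ 4 / (1 + L ^ 4) ≤ 1 := by rw [div_le_one (by positivity)]; linarith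
    nlinarith
  obtain ⟨K, hK⟩ : ∃ K, K = 8 * (1 + L) ^ 4 := ⟨_, rfl⟩
  have hK1 : 1 ≤ K := by
    have : 1 ≤ (1 + L) ^ 4 := one_le_pow₀ (by linarith)
    linarith
  obtain ⟨G, hG⟩ : ∃ G, G = 2 * K ^ 4 * (L + 4) := ⟨_, rfl⟩
  have hG0 : 0 < G := by rw [hG]; positivity
  obtain ⟨E, hE⟩ : ∃ E, E = Cpt K D k2 η * (L + 4) := ⟨_, rfl⟩
  have hE0 : 0 ≤ E := by rw [hE]; unfold Cpt; positivity
  obtain ⟨s, hs⟩ : ∃ s, s = min (k2 / 2 / (1 + L ^ 4)) (η * D / 2) := ⟨_, rfl⟩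
  have hs0 : 0 < s := by rw [hs]; exact lt_min (by positivity) (by positivity)
  have hs1 : s * (1 + L ^ 4) ≤ k2 / 2 := by
    rw [← le_div_iff₀ (by positivity), hs]; exact min_le_left _ _
  have hs2 : s ≤ η * D / 2 := hs ▸ min_le_right _ _
  obtain ⟨r, hr⟩ : ∃ r, r = min (min (D / 2) (1 / 2)) (η * k2 / 2) := ⟨_, rfl⟩
  have hr0 : 0 < r := by rw [hr]; exact lt_min (lt_min (by positivity) (by norm_num)) (by positivity)
  have hr1 : r ≤ D / 2 := hr ▸ (min_le_left _ _).trans (min_le_left _ _)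
  have hr2 : r ≤ 1 / 2 := hr ▸ (min_le_left _ _).trans (min_le_right _ _)
  have hr3 : r ≤ η * k2 / 2 := hr ▸ min_le_right _ _
  obtain ⟨b, hbe⟩ : ∃ b, b = 2 + L ^ 4 := ⟨_, rfl⟩
  have hb0 : 0 < b := by rw [hbe]; positivity
  have hb1 : 1 ≤ b := by rw [hbe]; linarith
  refine ⟨η, s / b, E + E ^ 2 / k2 + s / b * (10 * G) + 1, b / r,
    5 / 2 + 3 * D / 2 + η * k2 / 2 + 9 / 2 * G + r * (10 * G), by positivity, by positivity,
    by positivity, by positivity, ?_⟩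
  intro T hT w h t ht
  have hw := h.sm
  have X0' := XX_nonneg hw hL t
  have hbds := bds h hL hT ht (Real.sqrt_nonneg _) (Real.sqrt_nonneg _)
    (Real.sq_sqrt X0') (Real.sq_sqrt (NN_nonneg hL (P 3 w) t))
  rw [← hK] at hbds
  obtain ⟨n1, n2⟩ := nonlin h hL hK1 (Real.sq_sqrt X0') hbds
  have n3 := Rint h hL hD hk hη (Real.sqrt_nonneg _) (Real.sqrt_nonneg _) hK1
    (Real.sq_sqrt X0') (Real.sq_sqrt (NN_nonneg hL (P 3 w) t)) hbds
  rw [← hG] at n1 n2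
  rw [← hE] at n3
  have lo := Phi_lower (k2 := k2) hw hL hD η t
  have up := Phi_upper hw hL hD hk hη t
  have q1 := (poinc h hL hT 1 ht).1
  have q2 := (poinc h hL hT 2 ht).1
  have q3 := (poinc h hL hT 3 ht).1
  have q4 := (poinc h hL hT 0 ht).2.1
  have z1 := NN_nonneg hL (P 1 w) t
  have z2 := NN_nonneg hL (P 2 w) t
  have z3 := NN_nonneg hL (P 3 w) t
  have z4 := NN_nonneg hL (c 3 w) t
  have z5 := NN_nonneg hL (F 0 w) t
  generalize XX L w t = X at *
  generalize Phi L D k2 η w t = Φ at *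
  generalize (∫ x in (0:ℝ)..L, RR L D k2 η w x t) = J at *
  generalize NN L (g w) t = NG at *
  generalize NN L (P 1 w) t = Q at *
  generalize NN L (P 2 w) t = R at *
  generalize NN L (P 3 w) t = Y at *
  generalize NN L (c 3 w) t = c3 at *
  generalize NN L (F 0 w) t = F at *
  generalize NN L (c 2 w) t = c2 at *
  generalize NN L (c 1 w) t = c1 at *
  generalize NN L (P 0 w) t = P0 at *
  have hX2 : 0 ≤ X ^ 2 := by positivity
  have hX3 : 0 ≤ X ^ 3 := by positivity
  -- coercivity
  have co : X ≤ b * (Q + R + c3 + F) + 10 * G * X ^ 2 := by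
    have l1 : 0 ≤ L ^ 4 * c3 := by positivity
    rw [hbe]; linarith
  have co2 : X - 10 * G * X ^ 2 ≤ b * (Q + R + c3 + F) := by linarith
  have co3 : s / b * (X - 10 * G * X ^ 2) ≤ s * (Q + R + c3 + F) := by
    have := mul_le_mul_of_nonneg_left co2 (div_pos hs0 hb0).le
    have e : s / b * (b * (Q + R + c3 + F)) = s * (Q + R + c3 + F) := by field_simp
    linarith
  have co4 : b / r * (r * (Q + R + c3 + F)) = b * (Q + R + c3 + F) := by field_simp
  refine ⟨?_, ?_, ?_⟩
  · have d1 : η / D * c2 ≤ k2 / 2 * R := by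
      calc η / D * c2 ≤ η / D * (L ^ 4 * R) := by gcongr
        _ = η / D * L ^ 4 * R := by ring
        _ ≤ _ := by gcongr
    have d2 : s * c3 ≤ k2 / 2 * Y := by
      have e1 := mul_le_mul_of_nonneg_left q3 hs0.le
      have e2 := mul_le_mul_of_nonneg_right hs1 z3
      have e3 := mul_nonneg hs0.le z3
      linarith
    have hsk : s ≤ k2 / 2 := by
      have := mul_pos hs0 hL4
      linarith
    have d3 : s * Q ≤ k2 * Q := by gcongr; linarith
    have d4 : s * R ≤ k2 / 2 * R := by gcongr
    have d5 : s * F ≤ η * D / 2 * F := by gcongr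
    have p1 : 0 ≤ E ^ 2 / k2 * X ^ 2 := by positivity
    have p2 : 0 ≤ s / b * (10 * G) * X ^ 3 := by positivity
    linarith
  · have d1 : r * (Q + R + c3 + F) ≤ Φ + 9 / 2 * G * X ^ 2 := by
      have e1 := mul_le_mul_of_nonneg_right hr1 z1
      have e2 := mul_le_mul_of_nonneg_right hr1 z2
      have e3 := mul_le_mul_of_nonneg_right hr2 z4
      have e4 := mul_le_mul_of_nonneg_right hr3 z5
      linarith
    have d2 := mul_le_mul_of_nonneg_left d1 (div_pos hb0 hr0).le
    have e : b / r * (r * (10 * G)) = b * (10 * G) := by field_simp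
    have e' : b / r * (r * (10 * G)) * X ^ 2 = b * (10 * G) * X ^ 2 := by rw [e]
    have p1 : 0 ≤ b / r * (5 / 2 + 3 * D / 2 + η * k2 / 2) * X ^ 2 := by positivity
    have p2 : 10 * G * X ^ 2 ≤ b * (10 * G) * X ^ 2 := by
      have : 0 ≤ 10 * G * X ^ 2 := by positivity
      nlinarith
    linarith
  · have p1 : 0 ≤ (9 / 2 * G + r * (10 * G)) * X := by positivity
    have p2 : 0 ≤ (5 / 2 + 3 * D / 2 + η * k2 / 2 + r * (10 * G)) * X ^ 2 := by positivity
    linarith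

end Cant

end

section
open MeasureTheory Set

namespace Cant

lemma final_G (L D k2 : ℝ) (hL : 0 < L) (hD : 0 < D) (hk2 : 0 < k2) :
    ∃ C1 C2 C3 C4 C5 : ℝ, 0 < C1 ∧ 0 < C2 ∧ 0 < C3 ∧ 0 < C4 ∧ 0 < C5 ∧
      ∀ T : ℝ, 0 < T → ∀ w : ℝ → ℝ → ℝ, GSol L D k2 T w →
        XX L w T + C1 * (∫ s in (0:ℝ)..T, XX L w s)
          ≤ C2 * XX L w 0 + C3 * XX L w 0 ^ 2 + C4 * XX L w T ^ 2
            + C5 * ∫ s in (0:ℝ)..T, (XX L w s ^ 2 + XX L w s ^ 3) := by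
  obtain ⟨η, κ, C, A, B, hκ, hC, hA, hB, H⟩ := main_ineq L D k2 hL hD hk2
  refine ⟨A * κ, A * B, A * B, A * B, A * C, by positivity, by positivity, by positivity,
    by positivity, by positivity, ?_⟩
  intro T hT w h
  have hw := h.sm
  have cX := XX_cont (L := L) hw
  have H' := H T hT w h
  have c1 : Continuous (fun s => - κ * XX L w s) := by fun_prop
  have c2 : Continuous (fun s => C * (XX L w s ^ 2 + XX L w s ^ 3)) := by fun_prop
  have D1 := intervalIntegral.sub_le_integral_of_hasDeriv_right_of_le (a := 0) (b := T)
    (g := Phi L D k2 η w) (g' := fun t => ∫ x in (0:ℝ)..L, RR L D k2 η w x t)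
    (φ := fun s => - κ * XX L w s + C * (XX L w s ^ 2 + XX L w s ^ 3)) hT.le
    (fun t ht => (Phi_deriv h hL hT η ht).continuousAt.continuousWithinAt)
    (fun t ht => (Phi_deriv h hL hT η (Ioo_subset_Icc_self ht)).hasDerivWithinAt)
    ((c1.add c2).continuousOn.integrableOn_compact isCompact_Icc)
    (fun t ht => (H' t (Ioo_subset_Icc_self ht)).1)
  rw [intervalIntegral.integral_add (c1.intervalIntegrable _ _) (c2.intervalIntegrable _ _),
    intervalIntegral.integral_const_mul, intervalIntegral.integral_const_mul] at D1
  obtain ⟨-, h1, -⟩ := H' T ⟨hT.le, le_rfl⟩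
  obtain ⟨-, -, h2⟩ := H' 0 ⟨le_rfl, hT.le⟩
  have h3 := mul_le_mul_of_nonneg_left (add_le_add D1 h2) hA.le
  linarith

lemma final_all (L D k2 : ℝ) (hL : 0 < L) (hD : 0 < D) (hk2 : 0 < k2) :
    ∃ C1 C2 C3 C4 C5 : ℝ, 0 < C1 ∧ 0 < C2 ∧ 0 < C3 ∧ 0 < C4 ∧ 0 < C5 ∧
      ∀ T : ℝ, 0 < T → ∀ w : ℝ → ℝ → ℝ,
        IsFullSol L D k2 T (fun _ _ => 0) w →
        XX L w T + C1 * (∫ s in (0:ℝ)..T, XX L w s)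
          ≤ C2 * XX L w 0 + C3 * (XX L w 0 ^ 2 + XX L w 0 ^ 9 + XX L w 0 ^ 16)
            + C4 * (XX L w T ^ 2 + XX L w T ^ 9)
            + C5 * ∫ s in (0:ℝ)..T,
                (XX L w s ^ 2 + XX L w s ^ 3 + XX L w s ^ ((10:ℝ)/3) + XX L w s ^ 4
                  + XX L w s ^ 6 + XX L w s ^ 9 + XX L w s ^ 17) := by
  obtain ⟨C1, C2, C3, C4, C5, h1, h2, h3, h4, h5, H⟩ := final_G L D k2 hL hD hk2
  refine ⟨C1, C2, C3, C4, C5, h1, h2, h3, h4, h5, ?_⟩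
  intro T hT w0 hw0
  obtain ⟨U, hU, hbU, hsm⟩ := hw0.1
  obtain ⟨w, V, hw, hV, hbV, hEq⟩ := exists_global hU (isClosed_Icc.prod isClosed_Icc) hbU hsm
  have hG := GSol_of hL hV hbV hEq hw hw0
  have eX : ∀ t ∈ Icc (0:ℝ) T, XX L w0 t = XX L w t := fun t ht => X_congr hL hV hbV hEq ht
  have u : uIcc (0:ℝ) T = Icc 0 T := uIcc_of_le hT.le
  have e1 : ∫ s in (0:ℝ)..T, XX L w0 s = ∫ s in (0:ℝ)..T, XX L w s :=
    intervalIntegral.integral_congr fun s hs => eX s (u ▸ hs)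
  have e2 : (∫ s in (0:ℝ)..T, (XX L w0 s ^ 2 + XX L w0 s ^ 3 + XX L w0 s ^ ((10:ℝ)/3) + XX L w0 s ^ 4
                  + XX L w0 s ^ 6 + XX L w0 s ^ 9 + XX L w0 s ^ 17))
      = ∫ s in (0:ℝ)..T, (XX L w s ^ 2 + XX L w s ^ 3 + XX L w s ^ ((10:ℝ)/3) + XX L w s ^ 4
                  + XX L w s ^ 6 + XX L w s ^ 9 + XX L w s ^ 17) :=
    intervalIntegral.integral_congr fun s hs => by simp only [eX s (u ▸ hs)]
  rw [e1, e2, eX 0 ⟨le_rfl, hT.le⟩, eX T ⟨hT.le, le_rfl⟩]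
  have cX := XX_cont (L := L) hw
  have pX := XX_nonneg (L := L) hw hL
  have cr : Continuous fun s => XX L w s ^ ((10:ℝ)/3) :=
    cX.rpow_const fun s => Or.inr (by norm_num)
  have mono : ∫ s in (0:ℝ)..T, (XX L w s ^ 2 + XX L w s ^ 3) ≤
      ∫ s in (0:ℝ)..T, (XX L w s ^ 2 + XX L w s ^ 3 + XX L w s ^ ((10:ℝ)/3) + XX L w s ^ 4
                  + XX L w s ^ 6 + XX L w s ^ 9 + XX L w s ^ 17) := by
    refine intervalIntegral.integral_mono_on hT.le
      (Continuous.intervalIntegrable (by fun_prop) _ _)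
      (Continuous.intervalIntegrable (by fun_prop) _ _) fun s _ => ?_
    have := pX s
    have r := Real.rpow_nonneg this ((10:ℝ)/3)
    have r4 := pow_nonneg this 4
    have r6 := pow_nonneg this 6
    have r9 := pow_nonneg this 9
    have r17 := pow_nonneg this 17
    linarith
  have main := H T hT w hG
  have m5 := mul_le_mul_of_nonneg_left mono h5.le
  have n1 := mul_nonneg h3.le (pow_nonneg (pX 0) 9)
  have n2 := mul_nonneg h3.le (pow_nonneg (pX 0) 16)
  have n3 := mul_nonneg h4.le (pow_nonneg (pX T) 9)
  linarith

end Cant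

end

/-- Global integral inequality ((6.24) of the paper): for some constants
`C₁,…,C₅ > 0` depending only on `L, D, k₂`, every unforced classical solution
satisfies the barrier-type inequality for `X = X₀ + X₁ + X₂ + X₃`. -/
theorem global_integral_inequality
    (L D k2 : ℝ) (hL : 0 < L) (hD : 0 < D) (hk2 : 0 < k2) :
    ∃ C1 C2 C3 C4 C5 : ℝ, 0 < C1 ∧ 0 < C2 ∧ 0 < C3 ∧ 0 < C4 ∧ 0 < C5 ∧
      ∀ T : ℝ, 0 < T → ∀ w : ℝ → ℝ → ℝ,
        IsFullSol L D k2 T (fun _ _ => 0) w →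
        (let X : ℝ → ℝ := fun t => X0 L w t + X1 L w t + X2 L w t + X3 L w t
        X T + C1 * (∫ s in (0:ℝ)..T, X s)
          ≤ C2 * X 0 + C3 * (X 0 ^ 2 + X 0 ^ 9 + X 0 ^ 16)
            + C4 * (X T ^ 2 + X T ^ 9)
            + C5 * ∫ s in (0:ℝ)..T,
                (X s ^ 2 + X s ^ 3 + X s ^ ((10:ℝ)/3) + X s ^ 4
                  + X s ^ 6 + X s ^ 9 + X s ^ 17)) := by
  exact Cant.final_all L D k2 hL hD hk2
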